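/- arXiv:1805.02945 — 2 statements merged into one kernel-verified Lean document; each statement's English description precedes it below -/
import Mathlib

section
/- For every ε > 0 there exists a constant C = C(ε) > 0 such that for every integer k ≥ 5 and all positive integers m and n, f_k(m,n) ≤ C · (k·n)^ε · ( k^(4/3) · n² / m )^( (28/17) · 2^(k-5) ). -/
/-- `numSols k m n` is the number of nondecreasing `k`-tuples of positive integers
`(a₁, …, a_k)` with `m / n = 1/a₁ + ⋯ + 1/a_k`. -/
noncomputable def numSols (k m n : ℕ) : ℕ :=
  Nat.card {a : Fin k → ℕ // (∀ i, 0 < a i) ∧ Monotone a ∧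
    (m : ℚ) / n = ∑ i, (1 : ℚ) / a i}


open Finset

/-- The classical divisor bound. -/
lemma divisor_bound (ε : ℝ) (hε : 0 < ε) : ∃ C : ℝ, 1 ≤ C ∧ ∀ K : ℕ, 0 < K →
    (K.divisors.card : ℝ) ≤ C * (K : ℝ) ^ ε := by
  set C1 : ℝ := max 1 (1 / (ε * Real.log 2)) with hC1
  have hl2 : 0 < Real.log 2 := Real.log_pos (by norm_num)
  have hC1one : 1 ≤ C1 := le_max_left _ _
  obtain ⟨P0, hP0⟩ := exists_nat_ge ((2 : ℝ) ^ (1 / ε))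
  refine ⟨C1 ^ P0, one_le_pow₀ hC1one, fun K hK => ?_⟩
  have hK0 : K ≠ 0 := hK.ne'
  have hKprod : (K : ℝ) ^ ε = ∏ p ∈ K.primeFactors, ((p : ℝ) ^ ε) ^ (K.factorization p) := by
    conv_lhs => rw [← Nat.prod_factorization_pow_eq_self hK0]
    rw [Finsupp.prod, Nat.support_factorization]
    push_cast
    rw [← Real.finsetProd_rpow _ _ (fun i _ => by positivity)]
    refine Finset.prod_congr rfl fun p _ => ?_
    rw [← Real.rpow_natCast, ← Real.rpow_mul (by positivity), mul_comm, Real.rpow_mul (by positivity),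
      Real.rpow_natCast]
  rw [Nat.card_divisors hK0, hKprod]
  push_cast
  calc (∏ p ∈ K.primeFactors, ((K.factorization p : ℝ) + 1))
      ≤ ∏ p ∈ K.primeFactors, ((if p < P0 then C1 else 1) * ((p : ℝ) ^ ε) ^ (K.factorization p)) := by
        refine Finset.prod_le_prod (fun _ _ => by positivity) fun p hp => ?_
        have hpp := Nat.prime_of_mem_primeFactors hp
        have hp2 : (2 : ℝ) ≤ p := by exact_mod_cast hpp.two_le
        set e := K.factorization p
        split_ifs with h
        · have h1 : (1 + (e : ℝ) * (ε * Real.log 2)) ≤ ((p : ℝ) ^ ε) ^ e := by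
            have h2 : Real.exp ((e : ℝ) * (ε * Real.log 2)) ≤ ((p : ℝ) ^ ε) ^ e := by
              rw [Real.exp_nat_mul]
              have : Real.exp (ε * Real.log 2) = (2 : ℝ) ^ ε := by
                rw [Real.rpow_def_of_pos (by norm_num), mul_comm]
              rw [this]
              gcongr
            have := Real.add_one_le_exp ((e : ℝ) * (ε * Real.log 2))
            linarith
          have h3 : 1 / (ε * Real.log 2) ≤ C1 := le_max_right _ _
          have hpos : 0 < ε * Real.log 2 := by positivity
          rw [div_le_iff₀ hpos] at h3
          calc (e : ℝ) + 1 ≤ C1 * (1 + (e : ℝ) * (ε * Real.log 2)) := by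
                have : (0 : ℝ) ≤ e := by positivity
                nlinarith
            _ ≤ _ := by gcongr
        · have hpP : (P0 : ℝ) ≤ p := by exact_mod_cast not_lt.mp h
          have h2 : (2 : ℝ) ≤ (p : ℝ) ^ ε := by
            calc (2 : ℝ) = ((2 : ℝ) ^ (1 / ε)) ^ ε := by
                  rw [← Real.rpow_mul (by norm_num), one_div_mul_cancel hε.ne', Real.rpow_one]
              _ ≤ _ := by
                  gcongr
                  linarith
          rw [one_mul]
          calc (e : ℝ) + 1 ≤ (2 : ℝ) ^ e := by exact_mod_cast Nat.lt_two_pow_self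
            _ ≤ _ := by gcongr
    _ = (∏ p ∈ K.primeFactors, (if p < P0 then C1 else 1)) *
          ∏ p ∈ K.primeFactors, ((p : ℝ) ^ ε) ^ (K.factorization p) := Finset.prod_mul_distrib
    _ ≤ _ := by
        gcongr
        rw [← Finset.prod_filter, Finset.prod_const]
        refine pow_le_pow_right₀ hC1one ?_
        calc _ ≤ (Finset.range P0).card := by
              refine Finset.card_le_card fun p hp => ?_
              simp at hp ⊢
              exact hp.2
          _ = P0 := by simp

open Classical in
/-- number of distinct values of `κ` on `s` -/
noncomputable def NK {α β : Type} (s : Finset α) (κ : α → β) : ℕ := (s.image κ).card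

/-- one divisor step -/
lemma NK_step {α β : Type} (D M : ℕ) (hD : ∀ K : ℕ, 0 < K → K ≤ M → K.divisors.card ≤ D)
    (s : Finset α) (κ : α → β) (f G : α → ℕ)
    (hdvd : ∀ a ∈ s, f a ∣ G a) (hpos : ∀ a ∈ s, 0 < G a) (hle : ∀ a ∈ s, G a ≤ M)
    (hdet : ∀ a ∈ s, ∀ b ∈ s, κ a = κ b → G a = G b) :
    NK s (fun a => (κ a, f a)) ≤ D * NK s κ := by
  classical
  unfold NK
  have himg : s.image κ = (s.image (fun a => (κ a, f a))).image Prod.fst := by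
    rw [Finset.image_image]; rfl
  have := Finset.card_le_mul_card_image (f := Prod.fst) (s.image (fun a => (κ a, f a))) D ?_
  · rw [← himg] at this
    convert this
  · intro b hb
    rw [← himg] at hb
    obtain ⟨a, ha, rfl⟩ := Finset.mem_image.mp hb
    refine le_trans ?_ (hD (G a) (hpos a ha) (hle a ha))
    refine le_trans (Finset.card_le_card (t := (G a).divisors.image (fun c => (κ a, c))) ?_)
      Finset.card_image_le
    intro x hx
    obtain ⟨hx1, hx2⟩ := Finset.mem_filter.mp hx
    obtain ⟨b, hb, rfl⟩ := Finset.mem_image.mp hx1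
    refine Finset.mem_image.mpr ⟨f b, ?_, by simpa using hx2.symm⟩
    rw [Nat.mem_divisors]
    have := hdet b hb a ha hx2
    exact ⟨this ▸ hdvd b hb, (hpos a ha).ne'⟩

lemma NK_inj {α β : Type} (s : Finset α) (κ : α → β)
    (h : ∀ a ∈ s, ∀ b ∈ s, κ a = κ b → a = b) : s.card = NK s κ := by
  classical
  unfold NK
  rw [Finset.card_image_of_injOn]
  intro a ha b hb hab
  exact h a ha b hb hab

/-- number of values of a key `(A, j)` with `j ≤ T A` -/
lemma NK_pair {α : Type} (s : Finset α) (A j : α → ℕ) (I : Finset ℕ) (T : ℕ → ℝ)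
    (hT : ∀ a ∈ I, 0 ≤ T a)
    (hA : ∀ a ∈ s, A a ∈ I) (hj : ∀ a ∈ s, (j a : ℝ) ≤ T (A a)) :
    (NK s (fun a => (A a, j a)) : ℝ) ≤ ∑ a ∈ I, (T a + 1) := by
  classical
  unfold NK
  have h1 : (s.image (fun a => (A a, j a))).card ≤
      (I.sigma (fun a => Finset.range (⌊T a⌋₊ + 1))).card := by
    refine Finset.card_le_card_of_injOn (fun x => ⟨x.1, x.2⟩) ?_ ?_
    · intro x hx
      obtain ⟨a, ha, rfl⟩ := Finset.mem_image.mp (Finset.mem_coe.mp hx)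
      simp only [Finset.coe_sigma, Set.mem_sigma_iff, Finset.mem_coe, Finset.mem_range]
      exact ⟨hA a ha, Nat.lt_succ_of_le (Nat.le_floor (hj a ha))⟩
    · intro x _ y _ h
      simp only [Sigma.mk.injEq, heq_eq_eq] at h
      exact Prod.ext h.1 h.2
  calc _ ≤ ((I.sigma (fun a => Finset.range (⌊T a⌋₊ + 1))).card : ℝ) := by
        refine le_trans ?_ (Nat.cast_le.mpr h1)
        apply le_of_eq; congr!
    _ = ∑ a ∈ I, ((⌊T a⌋₊ : ℝ) + 1) := by
        rw [Finset.card_sigma]; push_cast; simp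
    _ ≤ _ := by
        refine Finset.sum_le_sum fun a ha => ?_
        gcongr
        exact Nat.floor_le (hT a ha)

/-- The parameters attached to a solution with four unit fractions. -/
@[ext] structure Conf where
  u0 : ℕ
  v0 : ℕ
  l : ℕ
  p : ℕ
  q : ℕ
  f : ℕ
  s : ℕ
  y : ℕ
  z : ℕ
  g : ℕ
  d : ℕ
  x : ℕ
  e : ℕ

def Conf.A1 (c : Conf) : ℕ := c.p * c.q * (c.f * c.s)
def Conf.A2 (c : Conf) : ℕ := c.y * c.z * (c.g * c.d)

/-- the relations between the parameters -/
structure Valid (m n Q : ℕ) (c : Conf) : Prop where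
  hn : c.u0 * c.v0 * c.l = n
  he : c.e + n * c.A1 + n * c.A2 = m * c.A1 * c.A2
  hg : c.g ∣ n * c.A1
  hf : c.f ∣ n * c.A2
  hx : c.x * c.e = c.f * c.g * c.l * (c.u0 * c.p * c.y + c.v0 * c.q * c.z)
  cqy : Nat.Coprime c.q c.y
  cpz : Nat.Coprime c.p c.z
  pu0 : 0 < c.u0
  pv0 : 0 < c.v0
  pl : 0 < c.l
  pp : 0 < c.p
  pq : 0 < c.q
  pf : 0 < c.f
  ps : 0 < c.s
  py : 0 < c.y
  pz : 0 < c.z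
  pg : 0 < c.g
  pd : 0 < c.d
  px : 0 < c.x
  pe : 0 < c.e
  pm : 0 < m
  pn : 0 < n
  bu0 : c.u0 ≤ Q
  bv0 : c.v0 ≤ Q
  bl : c.l ≤ Q
  bp : c.p ≤ Q
  bq : c.q ≤ Q
  bf : c.f ≤ Q
  bs : c.s ≤ Q
  by' : c.y ≤ Q
  bz : c.z ≤ Q
  bg : c.g ≤ Q
  bd : c.d ≤ Q
  bx : c.x ≤ Q
  be : c.e ≤ Q
  bm : m ≤ Q
  bn : n ≤ Q
  bA1 : c.A1 ≤ Q
  bA2 : c.A2 ≤ Q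
  bQ : 2 ≤ Q

namespace Conf

def swap1 (c : Conf) : Conf :=
  ⟨c.u0, c.v0, c.l, c.y, c.z, c.g, c.d, c.p, c.q, c.f, c.s, c.x, c.e⟩

def swap2 (c : Conf) : Conf :=
  ⟨c.v0, c.u0, c.l, c.q, c.p, c.f, c.s, c.z, c.y, c.g, c.d, c.x, c.e⟩

lemma swap1_swap1 (c : Conf) : c.swap1.swap1 = c := rfl
lemma swap2_swap2 (c : Conf) : c.swap2.swap2 = c := rfl

lemma swap1_A1 (c : Conf) : c.swap1.A1 = c.A2 := rfl
lemma swap1_A2 (c : Conf) : c.swap1.A2 = c.A1 := rfl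
lemma swap2_A1 (c : Conf) : c.swap2.A1 = c.A1 := by
  simp only [A1, swap2]; ring
lemma swap2_A2 (c : Conf) : c.swap2.A2 = c.A2 := by
  simp only [A2, swap2]; ring

end Conf

namespace Valid

variable {m n Q : ℕ} {c c' : Conf}

lemma swap1 (h : Valid m n Q c) : Valid m n Q c.swap1 := by
  obtain ⟨h1, h2, h3, h4, h5, h6, h7, h8, h9, h10, h11, h12, h13, h14, h15, h16, h17, h18, h19,
    h20, h21, h22, h23, h24, h25, h26, h27, h28, h29, h30, h31, h32, h33, h34, h35, h36, h37, h38,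
    h39, h40⟩ := h
  refine ⟨h1, ?_, h4, h3, ?_, h7.symm, h6.symm, h8, h9, h10, h15, h16, h17, h18, h11, h12, h13, h14,
    h19, h20, h21, h22, h23, h24, h25, h30, h31, h32, h33, h26, h27, h28, h29, h34, h35, h36, h37,
    h39, h38, h40⟩
  · rw [Conf.swap1_A1, Conf.swap1_A2]
    simp only [Conf.swap1]
    linarith
  · simp only [Conf.swap1]
    linarith

lemma swap2 (h : Valid m n Q c) : Valid m n Q c.swap2 := by
  obtain ⟨h1, h2, h3, h4, h5, h6, h7, h8, h9, h10, h11, h12, h13, h14, h15, h16, h17, h18, h19,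
    h20, h21, h22, h23, h24, h25, h26, h27, h28, h29, h30, h31, h32, h33, h34, h35, h36, h37, h38,
    h39, h40⟩ := h
  refine ⟨?_, ?_, ?_, ?_, ?_, h7, h6, h9, h8, h10, h12, h11, h13, h14, h16, h15, h17, h18,
    h19, h20, h21, h22, h24, h23, h25, h27, h26, h28, h29, h31, h30, h32, h33, h34, h35, h36, h37,
    ?_, ?_, h40⟩
  · simp only [Conf.swap2]; linarith
  · rw [Conf.swap2_A1, Conf.swap2_A2]; exact h2
  · rw [Conf.swap2_A1]; exact h3
  · rw [Conf.swap2_A2]; exact h4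
  · simp only [Conf.swap2]; linarith
  · rw [Conf.swap2_A1]; exact h38
  · rw [Conf.swap2_A2]; exact h39

lemma pA1 (h : Valid m n Q c) : 0 < c.A1 := by
  have := h.pp; have := h.pq; have := h.pf; have := h.ps
  unfold Conf.A1; positivity

lemma pA2 (h : Valid m n Q c) : 0 < c.A2 := h.swap1.pA1

/-- `m * A1 - n > 0` -/
lemma n_lt (h : Valid m n Q c) : n < m * c.A1 := by
  have h1 := h.he
  have h2 := h.pe
  by_contra hcon
  have : m * c.A1 * c.A2 ≤ n * c.A2 := Nat.mul_le_mul_right _ (not_lt.mp hcon)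
  omega

lemma he' (h : Valid m n Q c) : c.e + n * c.A1 = (m * c.A1 - n) * c.A2 := by
  have h1 := h.he
  rw [Nat.sub_mul]
  omega

lemma det_l (h : Valid m n Q c) (h' : Valid m n Q c') (hu : c.u0 = c'.u0) (hv : c.v0 = c'.v0) :
    c.l = c'.l := by
  have h1 := h.hn
  rw [← h'.hn, hu, hv] at h1
  exact Nat.eq_of_mul_eq_mul_left (Nat.mul_pos h'.pu0 h'.pv0) h1

lemma det_S (h' : Valid m n Q c') (hA : c.A1 = c'.A1) (hp : c.p = c'.p)
    (hq : c.q = c'.q) : c.f * c.s = c'.f * c'.s := by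
  unfold Conf.A1 at hA
  rw [hp, hq] at hA
  exact Nat.eq_of_mul_eq_mul_left (Nat.mul_pos h'.pp h'.pq) hA

lemma det_A2 (h : Valid m n Q c) (h' : Valid m n Q c') (hA : c.A1 = c'.A1) (he : c.e = c'.e) :
    c.A2 = c'.A2 := by
  have h1 := h.he'
  have h2 := h'.he'
  rw [hA, he, h2] at h1
  have := h'.n_lt
  exact (Nat.eq_of_mul_eq_mul_left (by omega) h1).symm

lemma det_e (h : Valid m n Q c) (h' : Valid m n Q c') (hA : c.A1 = c'.A1) (hA2 : c.A2 = c'.A2) :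
    c.e = c'.e := by
  have h1 := h.he'
  have h2 := h'.he'
  rw [hA, hA2, ← h2] at h1
  omega

/-- everything is determined -/
lemma det_all (h : Valid m n Q c) (h' : Valid m n Q c') (hu : c.u0 = c'.u0) (hv : c.v0 = c'.v0)
    (hA : c.A1 = c'.A1) (hA2 : c.A2 = c'.A2) (hp : c.p = c'.p) (hq : c.q = c'.q) (hf : c.f = c'.f)
    (hy : c.y = c'.y) (hz : c.z = c'.z) (hg : c.g = c'.g) : c = c' := by
  have hl := h.det_l h' hu hv
  have hS := h'.det_S hA hp hq
  have hs : c.s = c'.s := by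
    rw [hf] at hS; exact Nat.eq_of_mul_eq_mul_left h'.pf hS
  have hD := h'.swap1.det_S (c := c.swap1) hA2 hy hz
  have hd : c.d = c'.d := by
    simp only [Conf.swap1] at hD
    rw [hg] at hD; exact Nat.eq_of_mul_eq_mul_left h'.pg hD
  have he := h.det_e h' hA hA2
  have hx : c.x = c'.x := by
    have h1 := h.hx
    rw [he, hf, hg, hl, hu, hv, hp, hq, hy, hz, ← h'.hx] at h1
    exact Nat.eq_of_mul_eq_mul_right h'.pe h1
  ext <;> assumption

/-- `e` divides the basic expression -/
lemma e_dvd (h : Valid m n Q c) :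
    c.e ∣ c.l * (c.f * c.s) * (c.g * c.d) * (c.u0 * c.p * c.y + c.v0 * c.q * c.z) := by
  refine ⟨c.x * (c.s * c.d), ?_⟩
  calc _ = (c.f * c.g * c.l * (c.u0 * c.p * c.y + c.v0 * c.q * c.z)) * (c.s * c.d) := by ring
    _ = _ := by rw [← h.hx]; ring

lemma e_dvd_yz (h : Valid m n Q c) :
    c.e ∣ c.l * (c.f * c.s) * (c.u0 * c.p * c.y + c.v0 * c.q * c.z) * (n * c.A1) := by
  set U := c.u0 * c.p * c.y + c.v0 * c.q * c.z
  have h1 : c.e ∣ c.l * (c.f * c.s) * U * (c.e + n * c.A1) := by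
    rw [h.he']
    refine dvd_trans h.e_dvd ⟨(m * c.A1 - n) * (c.y * c.z), ?_⟩
    unfold Conf.A2
    ring
  rw [mul_add] at h1
  exact (Nat.dvd_add_right (Dvd.intro_left _ rfl)).mp h1

lemma e_dvd_yd (h : Valid m n Q c) :
    c.e ∣ c.l * (c.f * c.s) * (c.g * c.d) * ((c.y * (c.g * c.d) * (m * c.A1 - n)) *
      (c.u0 * c.p * c.y) + c.v0 * c.q * (n * c.A1)) := by
  have h1 : c.e ∣ c.l * (c.f * c.s) * (c.g * c.d) * ((c.y * (c.g * c.d) * (m * c.A1 - n)) *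
      (c.u0 * c.p * c.y) + c.v0 * c.q * (c.e + n * c.A1)) := by
    rw [h.he']
    refine dvd_trans h.e_dvd ⟨(m * c.A1 - n) * (c.y * (c.g * c.d)), ?_⟩
    unfold Conf.A2
    ring
  have h2 : c.l * (c.f * c.s) * (c.g * c.d) * ((c.y * (c.g * c.d) * (m * c.A1 - n)) *
      (c.u0 * c.p * c.y) + c.v0 * c.q * (c.e + n * c.A1)) =
      (c.l * (c.f * c.s) * (c.g * c.d) * (c.v0 * c.q)) * c.e +
      c.l * (c.f * c.s) * (c.g * c.d) * ((c.y * (c.g * c.d) * (m * c.A1 - n)) *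
      (c.u0 * c.p * c.y) + c.v0 * c.q * (n * c.A1)) := by ring
  rw [h2] at h1
  exact (Nat.dvd_add_right (Dvd.intro_left _ rfl)).mp h1

lemma le_pow {k j : ℕ} (h : Valid m n Q c) (hk : k ≤ Q ^ j) (hj : j ≤ 20) : k ≤ Q ^ 20 :=
  hk.trans (Nat.pow_le_pow_right (by have := h.bQ; omega) hj)

lemma le_one (h : Valid m n Q c) {k : ℕ} (hk : k ≤ Q) : k ≤ Q ^ 20 :=
  h.le_pow (j := 1) (by simpa using hk) (by norm_num)

lemma dvdA1 (c : Conf) : c.p ∣ c.A1 ∧ c.q ∣ c.A1 ∧ c.f ∣ c.A1 :=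
  ⟨⟨c.q * (c.f * c.s), by unfold Conf.A1; ring⟩, ⟨c.p * (c.f * c.s), by unfold Conf.A1; ring⟩,
    ⟨c.p * c.q * c.s, by unfold Conf.A1; ring⟩⟩

lemma dvdA2 (c : Conf) : c.y ∣ c.A2 ∧ c.z ∣ c.A2 ∧ c.g ∣ c.A2 := dvdA1 c.swap1

lemma dvdn (h : Valid m n Q c) : c.u0 ∣ n ∧ c.v0 ∣ n :=
  ⟨⟨c.v0 * c.l, by rw [← h.hn]; ring⟩, ⟨c.u0 * c.l, by rw [← h.hn]; ring⟩⟩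

end Valid

section Count

variable {m n Q D : ℕ}

lemma count_yz (hD : ∀ K : ℕ, 0 < K → K ≤ Q ^ 20 → K.divisors.card ≤ D) (s : Finset Conf)
    (hs : ∀ c ∈ s, Valid m n Q c) :
    s.card ≤ D ^ 8 * NK s (fun c => (c.A1, c.y * c.z)) := by
  have e1 := NK_step D _ hD s (fun c => (c.A1, c.y * c.z)) (fun c => c.y) (fun c => c.y * c.z)
    (fun c _ => Dvd.intro _ rfl) (fun c hc => Nat.mul_pos (hs c hc).py (hs c hc).pz)
    (fun c hc => (hs c hc).le_pow (j := 2) (by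
      rw [pow_two]; exact Nat.mul_le_mul (hs c hc).by' (hs c hc).bz) (by norm_num))
    (by intro a ha b hb h; simp only [Prod.mk.injEq] at h; exact h.2)
  have e2 := NK_step D _ hD s (fun c => c.u0) (fun c => n)
    (fun c hc => (hs c hc).dvdn.1) (fun c hc => (hs c hc).pn)
    (fun c hc => (hs c hc).le_one (hs c hc).bn)
    (fun a _ b _ _ => rfl) (κ := fun c => ((c.A1, c.y * c.z), c.y))
  have e3 := NK_step D _ hD s (fun c => c.v0) (fun c => n)
    (fun c hc => (hs c hc).dvdn.2) (fun c hc => (hs c hc).pn)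
    (fun c hc => (hs c hc).le_one (hs c hc).bn)
    (fun a _ b _ _ => rfl) (κ := fun c => (((c.A1, c.y * c.z), c.y), c.u0))
  have e4 := NK_step D _ hD s (fun c => c.p) (fun c => c.A1)
    (fun c hc => (Valid.dvdA1 c).1) (fun c hc => (hs c hc).pA1)
    (fun c hc => (hs c hc).le_one (hs c hc).bA1)
    (by intro a ha b hb h; simp only [Prod.mk.injEq] at h; exact h.1.1.1.1)
    (κ := fun c => ((((c.A1, c.y * c.z), c.y), c.u0), c.v0))
  have e5 := NK_step D _ hD s (fun c => c.q) (fun c => c.A1)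
    (fun c hc => (Valid.dvdA1 c).2.1) (fun c hc => (hs c hc).pA1)
    (fun c hc => (hs c hc).le_one (hs c hc).bA1)
    (by intro a ha b hb h; simp only [Prod.mk.injEq] at h; exact h.1.1.1.1.1)
    (κ := fun c => (((((c.A1, c.y * c.z), c.y), c.u0), c.v0), c.p))
  have e6 := NK_step D _ hD s (fun c => c.f) (fun c => c.A1)
    (fun c hc => (Valid.dvdA1 c).2.2) (fun c hc => (hs c hc).pA1)
    (fun c hc => (hs c hc).le_one (hs c hc).bA1)
    (by intro a ha b hb h; simp only [Prod.mk.injEq] at h; exact h.1.1.1.1.1.1)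
    (κ := fun c => ((((((c.A1, c.y * c.z), c.y), c.u0), c.v0), c.p), c.q))
  have e7 := NK_step D _ hD s (fun c => c.e)
    (fun c => c.l * (c.f * c.s) * (c.u0 * c.p * c.y + c.v0 * c.q * c.z) * (n * c.A1))
    (fun c hc => (hs c hc).e_dvd_yz) (fun c hc => by
      have h := hs c hc
      have := h.pA1; have := h.pn; have := h.pl; have := h.pf; have := h.ps; have := h.pu0
      have := h.pp; have := h.py; positivity)
    (fun c hc => by
      have h := hs c hc
      have := h.bl; have := h.bf; have := h.bs; have := h.bu0; have := h.bv0; have := h.bp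
      have := h.bq; have := h.by'; have := h.bz; have := h.bn; have := h.bA1
      refine h.le_pow (j := 9) ?_ (by norm_num)
      calc _ ≤ Q * (Q * Q) * (Q * Q * Q + Q * Q * Q) * (Q * Q) := by gcongr
        _ = 2 * Q ^ 8 := by ring
        _ ≤ Q * Q ^ 8 := by have := h.bQ; gcongr
        _ = Q ^ 9 := by ring)
    (by
      intro a ha b hb h; simp only [Prod.mk.injEq] at h
      obtain ⟨⟨⟨⟨⟨⟨⟨h1, h2⟩, h3⟩, h4⟩, h5⟩, h6⟩, h7⟩, h8⟩ := h
      have hl := (hs a ha).det_l (hs b hb) h4 h5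
      have hS := (hs b hb).det_S h1 h6 h7
      have hz : a.z = b.z := by
        rw [h3] at h2; exact Nat.eq_of_mul_eq_mul_left (hs b hb).py h2
      rw [hl, hS, h3, h4, h5, h6, h7, hz, h1])
    (κ := fun c => (((((((c.A1, c.y * c.z), c.y), c.u0), c.v0), c.p), c.q), c.f))
  have e8 := NK_step D _ hD s (fun c => c.g) (fun c => c.A2)
    (fun c hc => (Valid.dvdA2 c).2.2) (fun c hc => (hs c hc).pA2)
    (fun c hc => (hs c hc).le_one (hs c hc).bA2)
    (by
      intro a ha b hb h; simp only [Prod.mk.injEq] at h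
      exact (hs a ha).det_A2 (hs b hb) h.1.1.1.1.1.1.1.1 h.2)
    (κ := fun c => ((((((((c.A1, c.y * c.z), c.y), c.u0), c.v0), c.p), c.q), c.f), c.e))
  have e9 := NK_inj s (fun c => (((((((((c.A1, c.y * c.z), c.y), c.u0), c.v0), c.p), c.q), c.f), c.e),
    c.g)) (by
      intro a ha b hb h; simp only [Prod.mk.injEq] at h
      obtain ⟨⟨⟨⟨⟨⟨⟨⟨⟨h1, h2⟩, h3⟩, h4⟩, h5⟩, h6⟩, h7⟩, h8⟩, h9⟩, h10⟩ := h
      have hz : a.z = b.z := by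
        rw [h3] at h2; exact Nat.eq_of_mul_eq_mul_left (hs b hb).py h2
      exact (hs a ha).det_all (hs b hb) h4 h5 h1 ((hs a ha).det_A2 (hs b hb) h1 h9) h6 h7 h8 h3 hz h10)
  rw [e9]
  refine e8.trans ?_
  refine (Nat.mul_le_mul_left D (e7.trans (Nat.mul_le_mul_left D (e6.trans (Nat.mul_le_mul_left D
    (e5.trans (Nat.mul_le_mul_left D (e4.trans (Nat.mul_le_mul_left D (e3.trans
    (Nat.mul_le_mul_left D (e2.trans (Nat.mul_le_mul_left D e1))))))))))))).trans (le_of_eq ?_)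
  ring

lemma count_yd (hD : ∀ K : ℕ, 0 < K → K ≤ Q ^ 20 → K.divisors.card ≤ D) (s : Finset Conf)
    (hs : ∀ c ∈ s, Valid m n Q c) :
    s.card ≤ D ^ 8 * NK s (fun c => (c.A1, c.y * c.d)) := by
  have e1 := NK_step D _ hD s (fun c => (c.A1, c.y * c.d)) (fun c => c.y) (fun c => c.y * c.d)
    (fun c _ => Dvd.intro _ rfl) (fun c hc => Nat.mul_pos (hs c hc).py (hs c hc).pd)
    (fun c hc => (hs c hc).le_pow (j := 2) (by
      rw [pow_two]; exact Nat.mul_le_mul (hs c hc).by' (hs c hc).bd) (by norm_num))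
    (by intro a ha b hb h; simp only [Prod.mk.injEq] at h; exact h.2)
  have e2 := NK_step D _ hD s (fun c => c.u0) (fun c => n)
    (fun c hc => (hs c hc).dvdn.1) (fun c hc => (hs c hc).pn)
    (fun c hc => (hs c hc).le_one (hs c hc).bn)
    (fun a _ b _ _ => rfl) (κ := fun c => ((c.A1, c.y * c.d), c.y))
  have e3 := NK_step D _ hD s (fun c => c.v0) (fun c => n)
    (fun c hc => (hs c hc).dvdn.2) (fun c hc => (hs c hc).pn)
    (fun c hc => (hs c hc).le_one (hs c hc).bn)
    (fun a _ b _ _ => rfl) (κ := fun c => (((c.A1, c.y * c.d), c.y), c.u0))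
  have e4 := NK_step D _ hD s (fun c => c.p) (fun c => c.A1)
    (fun c hc => (Valid.dvdA1 c).1) (fun c hc => (hs c hc).pA1)
    (fun c hc => (hs c hc).le_one (hs c hc).bA1)
    (by intro a ha b hb h; simp only [Prod.mk.injEq] at h; exact h.1.1.1.1)
    (κ := fun c => ((((c.A1, c.y * c.d), c.y), c.u0), c.v0))
  have e5 := NK_step D _ hD s (fun c => c.q) (fun c => c.A1)
    (fun c hc => (Valid.dvdA1 c).2.1) (fun c hc => (hs c hc).pA1)
    (fun c hc => (hs c hc).le_one (hs c hc).bA1)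
    (by intro a ha b hb h; simp only [Prod.mk.injEq] at h; exact h.1.1.1.1.1)
    (κ := fun c => (((((c.A1, c.y * c.d), c.y), c.u0), c.v0), c.p))
  have e6 := NK_step D _ hD s (fun c => c.f) (fun c => c.A1)
    (fun c hc => (Valid.dvdA1 c).2.2) (fun c hc => (hs c hc).pA1)
    (fun c hc => (hs c hc).le_one (hs c hc).bA1)
    (by intro a ha b hb h; simp only [Prod.mk.injEq] at h; exact h.1.1.1.1.1.1)
    (κ := fun c => ((((((c.A1, c.y * c.d), c.y), c.u0), c.v0), c.p), c.q))
  have e7 := NK_step D _ hD s (fun c => c.g) (fun c => n * c.A1)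
    (fun c hc => (hs c hc).hg) (fun c hc => Nat.mul_pos (hs c hc).pn (hs c hc).pA1)
    (fun c hc => (hs c hc).le_pow (j := 2) (by
      rw [pow_two]; exact Nat.mul_le_mul (hs c hc).bn (hs c hc).bA1) (by norm_num))
    (by intro a ha b hb h; simp only [Prod.mk.injEq] at h; rw [h.1.1.1.1.1.1.1])
    (κ := fun c => (((((((c.A1, c.y * c.d), c.y), c.u0), c.v0), c.p), c.q), c.f))
  have e8 := NK_step D _ hD s (fun c => c.e)
    (fun c => c.l * (c.f * c.s) * (c.g * c.d) * ((c.y * (c.g * c.d) * (m * c.A1 - n)) *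
      (c.u0 * c.p * c.y) + c.v0 * c.q * (n * c.A1)))
    (fun c hc => (hs c hc).e_dvd_yd) (fun c hc => by
      have h := hs c hc
      have := h.pA1; have := h.pn; have := h.pl; have := h.pf; have := h.ps; have := h.pv0
      have := h.pq; have := h.pg; have := h.pd; positivity)
    (fun c hc => by
      have h := hs c hc
      have := h.bl; have := h.bf; have := h.bs; have := h.bu0; have := h.bv0; have := h.bp
      have := h.bq; have := h.by'; have := h.bz; have := h.bn; have := h.bA1; have := h.bm
      have := h.bg; have := h.bd
      have hw : m * c.A1 - n ≤ Q * Q := (Nat.sub_le _ _).trans (by gcongr)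
      have hQ1 : 1 ≤ Q := by have := h.bQ; omega
      refine h.le_pow (j := 14) ?_ (by norm_num)
      calc _ ≤ Q * (Q * Q) * (Q * Q) * ((Q * (Q * Q) * (Q * Q)) * (Q * Q * Q) + Q * Q * (Q * Q)) := by
            gcongr
        _ = Q ^ 13 + Q ^ 9 := by ring
        _ ≤ Q ^ 13 + Q ^ 13 := by gcongr <;> norm_num
        _ = 2 * Q ^ 13 := by ring
        _ ≤ Q * Q ^ 13 := by have := h.bQ; gcongr
        _ = Q ^ 14 := by ring)
    (by
      intro a ha b hb h; simp only [Prod.mk.injEq] at h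
      obtain ⟨⟨⟨⟨⟨⟨⟨⟨h1, h2⟩, h3⟩, h4⟩, h5⟩, h6⟩, h7⟩, h8⟩, h9⟩ := h
      have hl := (hs a ha).det_l (hs b hb) h4 h5
      have hS := (hs b hb).det_S h1 h6 h7
      have hz : a.d = b.d := by
        rw [h3] at h2; exact Nat.eq_of_mul_eq_mul_left (hs b hb).py h2
      rw [hl, hS, h3, h4, h5, h6, h7, hz, h1, h9])
    (κ := fun c => ((((((((c.A1, c.y * c.d), c.y), c.u0), c.v0), c.p), c.q), c.f), c.g))
  have e9 := NK_inj s (fun c => (((((((((c.A1, c.y * c.d), c.y), c.u0), c.v0), c.p), c.q), c.f), c.g),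
    c.e)) (by
      intro a ha b hb h; simp only [Prod.mk.injEq] at h
      obtain ⟨⟨⟨⟨⟨⟨⟨⟨⟨h1, h2⟩, h3⟩, h4⟩, h5⟩, h6⟩, h7⟩, h8⟩, h9⟩, h10⟩ := h
      have hd : a.d = b.d := by
        rw [h3] at h2; exact Nat.eq_of_mul_eq_mul_left (hs b hb).py h2
      have hA2 := (hs a ha).det_A2 (hs b hb) h1 h10
      have hz : a.z = b.z := by
        have h11 := hA2
        unfold Conf.A2 at h11
        rw [h3, h9, hd] at h11
        have h12 := Nat.eq_of_mul_eq_mul_right (Nat.mul_pos (hs b hb).pg (hs b hb).pd) h11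
        exact Nat.eq_of_mul_eq_mul_left (hs b hb).py h12
      exact (hs a ha).det_all (hs b hb) h4 h5 h1 hA2 h6 h7 h8 h3 hz h9)
  rw [e9]
  refine e8.trans ?_
  refine (Nat.mul_le_mul_left D (e7.trans (Nat.mul_le_mul_left D (e6.trans (Nat.mul_le_mul_left D
    (e5.trans (Nat.mul_le_mul_left D (e4.trans (Nat.mul_le_mul_left D (e3.trans
    (Nat.mul_le_mul_left D (e2.trans (Nat.mul_le_mul_left D e1))))))))))))).trans (le_of_eq ?_)
  ring

lemma count_e (hD : ∀ K : ℕ, 0 < K → K ≤ Q ^ 20 → K.divisors.card ≤ D) (s : Finset Conf)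
    (hs : ∀ c ∈ s, Valid m n Q c) :
    s.card ≤ D ^ 8 * NK s (fun c => (c.A1, c.e / (m * c.A1 - n))) := by
  have hA2 : ∀ a ∈ s, ∀ b ∈ s, a.A1 = b.A1 → a.e / (m * a.A1 - n) = b.e / (m * b.A1 - n) →
      a.A2 = b.A2 := by
    intro a ha b hb h1 h2
    have ea := (hs a ha).he'
    have eb := (hs b hb).he'
    have hw := (hs b hb).n_lt
    rw [h1] at h2 ea
    set w := m * b.A1 - n with hwdef
    have hwpos : 0 < w := by omega
    have ma := Nat.div_add_mod a.e w
    have mb := Nat.div_add_mod b.e w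
    have la := Nat.mod_lt a.e hwpos
    have lb := Nat.mod_lt b.e hwpos
    rw [h2] at ma
    rcases lt_trichotomy a.A2 b.A2 with h | h | h
    · have : w * (a.A2 + 1) ≤ w * b.A2 := Nat.mul_le_mul_left _ h
      rw [mul_add] at this
      omega
    · exact h
    · have : w * (b.A2 + 1) ≤ w * a.A2 := Nat.mul_le_mul_left _ h
      rw [mul_add] at this
      omega
  have e2 := NK_step D _ hD s (fun c => c.u0) (fun c => n)
    (fun c hc => (hs c hc).dvdn.1) (fun c hc => (hs c hc).pn)
    (fun c hc => (hs c hc).le_one (hs c hc).bn)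
    (fun a _ b _ _ => rfl) (κ := fun c => (c.A1, c.e / (m * c.A1 - n)))
  have e3 := NK_step D _ hD s (fun c => c.v0) (fun c => n)
    (fun c hc => (hs c hc).dvdn.2) (fun c hc => (hs c hc).pn)
    (fun c hc => (hs c hc).le_one (hs c hc).bn)
    (fun a _ b _ _ => rfl) (κ := fun c => ((c.A1, c.e / (m * c.A1 - n)), c.u0))
  have e4 := NK_step D _ hD s (fun c => c.p) (fun c => c.A1)
    (fun c hc => (Valid.dvdA1 c).1) (fun c hc => (hs c hc).pA1)
    (fun c hc => (hs c hc).le_one (hs c hc).bA1)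
    (by intro a ha b hb h; simp only [Prod.mk.injEq] at h; exact h.1.1.1)
    (κ := fun c => (((c.A1, c.e / (m * c.A1 - n)), c.u0), c.v0))
  have e5 := NK_step D _ hD s (fun c => c.q) (fun c => c.A1)
    (fun c hc => (Valid.dvdA1 c).2.1) (fun c hc => (hs c hc).pA1)
    (fun c hc => (hs c hc).le_one (hs c hc).bA1)
    (by intro a ha b hb h; simp only [Prod.mk.injEq] at h; exact h.1.1.1.1)
    (κ := fun c => ((((c.A1, c.e / (m * c.A1 - n)), c.u0), c.v0), c.p))
  have e6 := NK_step D _ hD s (fun c => c.f) (fun c => c.A1)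
    (fun c hc => (Valid.dvdA1 c).2.2) (fun c hc => (hs c hc).pA1)
    (fun c hc => (hs c hc).le_one (hs c hc).bA1)
    (by intro a ha b hb h; simp only [Prod.mk.injEq] at h; exact h.1.1.1.1.1)
    (κ := fun c => (((((c.A1, c.e / (m * c.A1 - n)), c.u0), c.v0), c.p), c.q))
  have e7 := NK_step D _ hD s (fun c => c.y) (fun c => c.A2)
    (fun c hc => (Valid.dvdA2 c).1) (fun c hc => (hs c hc).pA2)
    (fun c hc => (hs c hc).le_one (hs c hc).bA2)
    (by
      intro a ha b hb h; simp only [Prod.mk.injEq] at h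
      exact hA2 a ha b hb h.1.1.1.1.1.1 h.1.1.1.1.1.2)
    (κ := fun c => ((((((c.A1, c.e / (m * c.A1 - n)), c.u0), c.v0), c.p), c.q), c.f))
  have e8 := NK_step D _ hD s (fun c => c.z) (fun c => c.A2)
    (fun c hc => (Valid.dvdA2 c).2.1) (fun c hc => (hs c hc).pA2)
    (fun c hc => (hs c hc).le_one (hs c hc).bA2)
    (by
      intro a ha b hb h; simp only [Prod.mk.injEq] at h
      exact hA2 a ha b hb h.1.1.1.1.1.1.1 h.1.1.1.1.1.1.2)
    (κ := fun c => (((((((c.A1, c.e / (m * c.A1 - n)), c.u0), c.v0), c.p), c.q), c.f), c.y))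
  have e9 := NK_step D _ hD s (fun c => c.g) (fun c => c.A2)
    (fun c hc => (Valid.dvdA2 c).2.2) (fun c hc => (hs c hc).pA2)
    (fun c hc => (hs c hc).le_one (hs c hc).bA2)
    (by
      intro a ha b hb h; simp only [Prod.mk.injEq] at h
      exact hA2 a ha b hb h.1.1.1.1.1.1.1.1 h.1.1.1.1.1.1.1.2)
    (κ := fun c => ((((((((c.A1, c.e / (m * c.A1 - n)), c.u0), c.v0), c.p), c.q), c.f), c.y), c.z))
  have e10 := NK_inj s (fun c => (((((((((c.A1, c.e / (m * c.A1 - n)), c.u0), c.v0), c.p), c.q),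
    c.f), c.y), c.z), c.g)) (by
      intro a ha b hb h; simp only [Prod.mk.injEq] at h
      obtain ⟨⟨⟨⟨⟨⟨⟨⟨⟨h1, h2⟩, h3⟩, h4⟩, h5⟩, h6⟩, h7⟩, h8⟩, h9⟩, h10⟩ := h
      exact (hs a ha).det_all (hs b hb) h3 h4 h1 (hA2 a ha b hb h1 h2) h5 h6 h7 h8 h9 h10)
  rw [e10]
  refine e9.trans ?_
  refine (Nat.mul_le_mul_left D (e8.trans (Nat.mul_le_mul_left D (e7.trans (Nat.mul_le_mul_left D
    (e6.trans (Nat.mul_le_mul_left D (e5.trans (Nat.mul_le_mul_left D (e4.trans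
    (Nat.mul_le_mul_left D (e3.trans (Nat.mul_le_mul_left D e2))))))))))))).trans (le_of_eq ?_)
  ring

end Count

lemma NK_box {α : Type} (s : Finset α) (a b c d : α → ℕ) (X J Z W : ℕ)
    (ha : ∀ t ∈ s, 1 ≤ a t ∧ a t ≤ X) (hb : ∀ t ∈ s, 1 ≤ b t ∧ b t ≤ J)
    (hc : ∀ t ∈ s, 1 ≤ c t ∧ c t ≤ Z) (hd : ∀ t ∈ s, 1 ≤ d t ∧ d t ≤ W) :
    NK s (fun t => ((a t, b t), (c t, d t))) ≤ X * J * (Z * W) := by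
  classical
  unfold NK
  have : s.image (fun t => ((a t, b t), (c t, d t))) ⊆
      (Finset.Icc 1 X ×ˢ Finset.Icc 1 J) ×ˢ (Finset.Icc 1 Z ×ˢ Finset.Icc 1 W) := by
    intro x hx
    obtain ⟨t, ht, rfl⟩ := Finset.mem_image.mp hx
    simp only [Finset.mem_product, Finset.mem_Icc]
    exact ⟨⟨ha t ht, hb t ht⟩, hc t ht, hd t ht⟩
  have := Finset.card_le_card this
  simp only [Finset.card_product, Nat.card_Icc, Nat.add_sub_cancel] at this
  convert this

section CountB

variable {m n Q D : ℕ}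

/-- the constants of the bilinear equation -/
def Conf.cB (n : ℕ) (c : Conf) : ℕ := c.x * n * c.z * (c.g * c.d) + c.f * c.g * c.l * c.u0 * c.p
def Conf.cA (m : ℕ) (c : Conf) : ℕ := c.x * m * c.p * c.q * c.z * (c.g * c.d)
def Conf.cC (n : ℕ) (c : Conf) : ℕ := c.x * n * c.p * c.q
def Conf.cE (c : Conf) : ℕ := c.f * c.g * c.l * c.v0 * c.q * c.z

lemma Valid.bilin {c : Conf} (h : Valid m n Q c) :
    c.cA m * (c.f * c.s) * c.y = c.cC n * (c.f * c.s) + c.y * c.cB n + c.cE := by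
  have h1 := h.he
  have h2 := h.hx
  have h3 : c.x * (c.e + n * c.A1 + n * c.A2) = c.x * (m * c.A1 * c.A2) := by rw [h1]
  unfold Conf.A1 Conf.A2 at h3
  unfold Conf.cA Conf.cB Conf.cC Conf.cE
  linarith

lemma Valid.q_dvd {c : Conf} (h : Valid m n Q c) : c.q ∣ c.cB n := by
  have h1 := h.bilin
  have h2 : c.q ∣ c.y * c.cB n := by
    have h3 : c.q ∣ c.y * c.cB n + (c.cC n * (c.f * c.s) + c.cE) := by
      refine ⟨c.x * m * c.p * c.z * (c.g * c.d) * (c.f * c.s) * c.y, ?_⟩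
      rw [show c.y * c.cB n + (c.cC n * (c.f * c.s) + c.cE) =
        c.cC n * (c.f * c.s) + c.y * c.cB n + c.cE by ring, ← h1]
      unfold Conf.cA; ring
    refine (Nat.dvd_add_left ?_).mp h3
    refine ⟨c.x * n * c.p * (c.f * c.s) + c.f * c.g * c.l * c.v0 * c.z, ?_⟩
    unfold Conf.cC Conf.cE; ring
  exact h.cqy.dvd_of_dvd_mul_left h2

lemma Valid.cB_pos {c : Conf} (h : Valid m n Q c) : 0 < c.cB n := by
  have := h.px; have := h.pn; have := h.pz; have := h.pg; have := h.pd
  unfold Conf.cB; positivity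

lemma Valid.cE_pos {c : Conf} (h : Valid m n Q c) : 0 < c.cE := by
  have := h.pf; have := h.pl; have := h.pz; have := h.pg; have := h.pv0; have := h.pq
  unfold Conf.cE; positivity

lemma Valid.cA_pos {c : Conf} (h : Valid m n Q c) : 0 < c.cA m := by
  have := h.px; have := h.pm; have := h.pz; have := h.pg; have := h.pd; have := h.pq; have := h.pp
  unfold Conf.cA; positivity

lemma Valid.cB_lt {c : Conf} (h : Valid m n Q c) : c.cB n < c.cA m * (c.f * c.s) := by
  have h1 := h.bilin
  have h2 := h.cE_pos
  by_contra hcon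
  have : c.cA m * (c.f * c.s) * c.y ≤ c.cB n * c.y := Nat.mul_le_mul_right _ (not_lt.mp hcon)
  rw [mul_comm (c.cB n)] at this
  omega

lemma Valid.key_mul {c : Conf} (h : Valid m n Q c) :
    (c.cA m * (c.f * c.s) - c.cB n) * c.y = c.cC n * (c.f * c.s) + c.cE := by
  have h1 := h.bilin
  rw [Nat.sub_mul, mul_comm (c.cB n)]
  omega

lemma Valid.key_dvd {c : Conf} (h : Valid m n Q c) :
    (c.cA m * (c.f * c.s) - c.cB n) ∣ c.cC n * c.cB n + c.cA m * c.cE := by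
  have h1 := h.key_mul
  obtain ⟨k, hk⟩ := Nat.exists_eq_add_of_lt h.cB_lt
  have hk' : c.cA m * (c.f * c.s) - c.cB n = k + 1 := by omega
  rw [hk'] at h1 ⊢
  have h4 : (k + 1) ∣ (k + 1) * c.cC n + (c.cC n * c.cB n + c.cA m * c.cE) := by
    refine ⟨c.cA m * c.y, ?_⟩
    calc (k + 1) * c.cC n + (c.cC n * c.cB n + c.cA m * c.cE)
        = c.cC n * (c.cB n + k + 1) + c.cA m * c.cE := by ring
      _ = c.cA m * (c.cC n * (c.f * c.s) + c.cE) := by rw [← hk]; ring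
      _ = _ := by rw [← h1]; ring
  exact (Nat.dvd_add_right (Dvd.intro _ rfl)).mp h4

lemma count_B (hD : ∀ K : ℕ, 0 < K → K ≤ Q ^ 20 → K.divisors.card ≤ D) (s : Finset Conf)
    (hs : ∀ c ∈ s, Valid m n Q c) :
    s.card ≤ D ^ 6 * NK s (fun c => ((c.x, c.f * c.p), (c.z, c.g * c.d))) := by
  have e1 := NK_step D _ hD s (fun c => ((c.x, c.f * c.p), (c.z, c.g * c.d))) (fun c => c.f)
    (fun c => c.f * c.p)
    (fun c _ => Dvd.intro _ rfl) (fun c hc => Nat.mul_pos (hs c hc).pf (hs c hc).pp)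
    (fun c hc => (hs c hc).le_pow (j := 2) (by
      rw [pow_two]; exact Nat.mul_le_mul (hs c hc).bf (hs c hc).bp) (by norm_num))
    (by intro a ha b hb h; simp only [Prod.mk.injEq] at h; exact h.1.2)
  have e2 := NK_step D _ hD s (fun c => c.g) (fun c => c.g * c.d)
    (fun c _ => Dvd.intro _ rfl) (fun c hc => Nat.mul_pos (hs c hc).pg (hs c hc).pd)
    (fun c hc => (hs c hc).le_pow (j := 2) (by
      rw [pow_two]; exact Nat.mul_le_mul (hs c hc).bg (hs c hc).bd) (by norm_num))
    (by intro a ha b hb h; simp only [Prod.mk.injEq] at h; exact h.1.2.2)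
    (κ := fun c => (((c.x, c.f * c.p), (c.z, c.g * c.d)), c.f))
  have e3 := NK_step D _ hD s (fun c => c.u0) (fun c => n)
    (fun c hc => (hs c hc).dvdn.1) (fun c hc => (hs c hc).pn)
    (fun c hc => (hs c hc).le_one (hs c hc).bn)
    (fun a _ b _ _ => rfl) (κ := fun c => ((((c.x, c.f * c.p), (c.z, c.g * c.d)), c.f), c.g))
  have e4 := NK_step D _ hD s (fun c => c.v0) (fun c => n)
    (fun c hc => (hs c hc).dvdn.2) (fun c hc => (hs c hc).pn)
    (fun c hc => (hs c hc).le_one (hs c hc).bn)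
    (fun a _ b _ _ => rfl)
    (κ := fun c => (((((c.x, c.f * c.p), (c.z, c.g * c.d)), c.f), c.g), c.u0))
  have hbB : ∀ c ∈ s, c.cB n ≤ 2 * Q ^ 5 := by
    intro c hc
    have h := hs c hc
    have := h.bl; have := h.bf; have := h.bu0; have := h.bp
    have := h.bz; have := h.bn; have := h.bg; have := h.bd; have := h.bx
    unfold Conf.cB
    calc _ ≤ Q * Q * Q * (Q * Q) + Q * Q * Q * Q * Q := by gcongr
      _ = _ := by ring
  have e5 := NK_step D _ hD s (fun c => c.q) (fun c => c.cB n)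
    (fun c hc => (hs c hc).q_dvd) (fun c hc => (hs c hc).cB_pos)
    (fun c hc => (hs c hc).le_pow (j := 6) (by
      have := (hs c hc).bQ
      calc _ ≤ _ := hbB c hc
        _ ≤ Q * Q ^ 5 := by gcongr
        _ = _ := by ring) (by norm_num))
    (by
      intro a ha b hb h; simp only [Prod.mk.injEq] at h
      obtain ⟨⟨⟨⟨⟨⟨h1, h2⟩, h3, h4⟩, h5⟩, h6⟩, h7⟩, h8⟩ := h
      have hl := (hs a ha).det_l (hs b hb) h7 h8
      have hp : a.p = b.p := by
        rw [h5] at h2; exact Nat.eq_of_mul_eq_mul_left (hs b hb).pf h2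
      unfold Conf.cB
      rw [h1, h3, h4, h5, h6, h7, hl, hp])
    (κ := fun c => ((((((c.x, c.f * c.p), (c.z, c.g * c.d)), c.f), c.g), c.u0), c.v0))
  have hdet : ∀ a ∈ s, ∀ b ∈ s,
      (((((((a.x, a.f * a.p), (a.z, a.g * a.d)), a.f), a.g), a.u0), a.v0), a.q) =
      (((((((b.x, b.f * b.p), (b.z, b.g * b.d)), b.f), b.g), b.u0), b.v0), b.q) →
      a.cA m = b.cA m ∧ a.cB n = b.cB n ∧ a.cC n = b.cC n ∧ a.cE = b.cE ∧ a.p = b.p := by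
    intro a ha b hb h; simp only [Prod.mk.injEq] at h
    obtain ⟨⟨⟨⟨⟨⟨⟨h1, h2⟩, h3, h4⟩, h5⟩, h6⟩, h7⟩, h8⟩, h9⟩ := h
    have hl := (hs a ha).det_l (hs b hb) h7 h8
    have hp : a.p = b.p := by
      rw [h5] at h2; exact Nat.eq_of_mul_eq_mul_left (hs b hb).pf h2
    unfold Conf.cA Conf.cB Conf.cC Conf.cE
    refine ⟨?_, ?_, ?_, ?_, hp⟩
    · rw [h1, h3, h4, h9, hp]
    · rw [h1, h3, h4, h5, h6, h7, hl, hp]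
    · rw [h1, h9, hp]
    · rw [h3, h5, h6, h8, hl, h9]
  have e6 := NK_step D _ hD s (fun c => c.cA m * (c.f * c.s) - c.cB n)
    (fun c => c.cC n * c.cB n + c.cA m * c.cE)
    (fun c hc => (hs c hc).key_dvd) (fun c hc => by
      have := (hs c hc).cA_pos; have := (hs c hc).cE_pos; positivity)
    (fun c hc => (hs c hc).le_pow (j := 15) (by
      have h := hs c hc
      have := h.bl; have := h.bf; have := h.bu0; have := h.bp; have := h.bv0; have := h.bm
      have := h.bz; have := h.bn; have := h.bg; have := h.bd; have := h.bx; have := h.bq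
      have hQ := h.bQ
      have hQ1 : 1 ≤ Q := by omega
      calc _ ≤ (Q * Q * Q * Q) * (2 * Q ^ 5) + (Q * Q * Q * Q * Q * (Q * Q)) *
            (Q * Q * Q * Q * Q * Q) := by
            have := hbB c hc
            unfold Conf.cC Conf.cA Conf.cE; gcongr
        _ = 2 * Q ^ 9 + Q ^ 13 := by ring
        _ ≤ 2 * Q ^ 13 + Q ^ 13 := by gcongr; norm_num
        _ = 3 * Q ^ 13 := by ring
        _ ≤ (Q * Q) * Q ^ 13 := by gcongr; nlinarith
        _ = Q ^ 15 := by ring) (by norm_num))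
    (by
      intro a ha b hb h
      obtain ⟨h1, h2, h3, h4, h5⟩ := hdet a ha b hb h
      rw [h1, h2, h3, h4])
    (κ := fun c => (((((((c.x, c.f * c.p), (c.z, c.g * c.d)), c.f), c.g), c.u0), c.v0), c.q))
  have e7 := NK_inj s (fun c => ((((((((c.x, c.f * c.p), (c.z, c.g * c.d)), c.f), c.g), c.u0), c.v0),
    c.q), c.cA m * (c.f * c.s) - c.cB n)) (by
      intro a ha b hb h
      rw [Prod.mk.injEq] at h
      obtain ⟨h0, hk⟩ := h
      obtain ⟨hA, hB, hC, hE, hp⟩ := hdet a ha b hb h0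
      simp only [Prod.mk.injEq] at h0
      obtain ⟨⟨⟨⟨⟨⟨⟨h1, h2⟩, h3, h4⟩, h5⟩, h6⟩, h7⟩, h8⟩, h9⟩ := h0
      have hva := hs a ha
      have hvb := hs b hb
      have la := hva.cB_lt
      have lb := hvb.cB_lt
      have hS : a.f * a.s = b.f * b.s := by
        have : a.cA m * (a.f * a.s) = b.cA m * (b.f * b.s) := by omega
        rw [hA] at this
        exact Nat.eq_of_mul_eq_mul_left hvb.cA_pos this
      have hy : a.y = b.y := by
        have ka := hva.key_mul
        have kb := hvb.key_mul
        rw [hk, hC, hS, hE, ← kb] at ka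
        exact Nat.eq_of_mul_eq_mul_left (by omega) ka
      have hA1 : a.A1 = b.A1 := by
        unfold Conf.A1; rw [hp, h9, hS]
      have hA2 : a.A2 = b.A2 := by
        unfold Conf.A2; rw [hy, h3, h4]
      exact hva.det_all hvb h7 h8 hA1 hA2 hp h9 h5 hy h3 h6)
  rw [e7]
  refine e6.trans ?_
  refine (Nat.mul_le_mul_left D (e5.trans (Nat.mul_le_mul_left D (e4.trans (Nat.mul_le_mul_left D
    (e3.trans (Nat.mul_le_mul_left D (e2.trans (Nat.mul_le_mul_left D e1))))))))).trans (le_of_eq ?_)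
  ring

lemma NK_image {α β γ : Type} [DecidableEq β] (s : Finset α) (φ : α → β) (κ : β → γ) :
    NK (s.image φ) κ = NK s (fun a => κ (φ a)) := by
  classical
  unfold NK
  congr 1
  ext t
  simp only [Finset.mem_image]
  constructor
  · rintro ⟨b, ⟨a, ha, rfl⟩, rfl⟩; exact ⟨a, ha, rfl⟩
  · rintro ⟨a, ha, rfl⟩; exact ⟨φ a, ⟨a, ha, rfl⟩, rfl⟩

lemma count_zd (hD : ∀ K : ℕ, 0 < K → K ≤ Q ^ 20 → K.divisors.card ≤ D) (s : Finset Conf)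
    (hs : ∀ c ∈ s, Valid m n Q c) :
    s.card ≤ D ^ 8 * NK s (fun c => (c.A1, c.z * c.d)) := by
  classical
  have h1 := count_yd hD (s.image Conf.swap2) (by
    intro c hc
    obtain ⟨c', hc', rfl⟩ := Finset.mem_image.mp hc
    exact (hs c' hc').swap2)
  rw [NK_image, Finset.card_image_of_injective] at h1
  · simp only [Conf.swap2_A1] at h1
    exact h1
  · intro a b h
    have := congrArg Conf.swap2 h
    simpa [Conf.swap2_swap2] using this

/-- Counting with `A1` in `I` and a small pair among `y, z, d`. -/
lemma count_pairs (hD : ∀ K : ℕ, 0 < K → K ≤ Q ^ 20 → K.divisors.card ≤ D) (s : Finset Conf)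
    (hs : ∀ c ∈ s, Valid m n Q c) (I : Finset ℕ) (T : ℕ → ℝ) (hT : ∀ a ∈ I, 0 ≤ T a)
    (hI : ∀ c ∈ s, c.A1 ∈ I)
    (hj : ∀ c ∈ s, ((c.y * c.z : ℕ) : ℝ) ≤ T c.A1 ∨ ((c.y * c.d : ℕ) : ℝ) ≤ T c.A1 ∨
      ((c.z * c.d : ℕ) : ℝ) ≤ T c.A1) :
    (s.card : ℝ) ≤ 3 * (D : ℝ) ^ 8 * ∑ a ∈ I, (T a + 1) := by
  classical
  set s1 := s.filter (fun c => ((c.y * c.z : ℕ) : ℝ) ≤ T c.A1)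
  set s2 := s.filter (fun c => ((c.y * c.d : ℕ) : ℝ) ≤ T c.A1)
  set s3 := s.filter (fun c => ((c.z * c.d : ℕ) : ℝ) ≤ T c.A1)
  have hcov : s ⊆ s1 ∪ s2 ∪ s3 := by
    intro c hc
    have := hj c hc
    simp only [s1, s2, s3, Finset.mem_union, Finset.mem_filter]
    tauto
  have hcard : s.card ≤ s1.card + s2.card + s3.card :=
    (Finset.card_le_card hcov).trans ((Finset.card_union_le _ _).trans
      (Nat.add_le_add_right (Finset.card_union_le _ _) _))
  have hs1 : ∀ c ∈ s1, c ∈ s := fun c hc => (Finset.mem_filter.mp hc).1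
  have hs2 : ∀ c ∈ s2, c ∈ s := fun c hc => (Finset.mem_filter.mp hc).1
  have hs3 : ∀ c ∈ s3, c ∈ s := fun c hc => (Finset.mem_filter.mp hc).1
  have c1 : (s1.card : ℝ) ≤ (D : ℝ) ^ 8 * ∑ a ∈ I, (T a + 1) := by
    have h1 := count_yz hD s1 (fun c hc => hs c (hs1 c hc))
    have h2 := NK_pair s1 Conf.A1 (fun c => c.y * c.z) I T hT (fun c hc => hI c (hs1 c hc))
      (fun c hc => (Finset.mem_filter.mp hc).2)
    calc (s1.card : ℝ) ≤ (D : ℝ) ^ 8 * (NK s1 (fun c => (c.A1, c.y * c.z)) : ℕ) := by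
          exact_mod_cast h1
      _ ≤ _ := by gcongr
  have c2 : (s2.card : ℝ) ≤ (D : ℝ) ^ 8 * ∑ a ∈ I, (T a + 1) := by
    have h1 := count_yd hD s2 (fun c hc => hs c (hs2 c hc))
    have h2 := NK_pair s2 Conf.A1 (fun c => c.y * c.d) I T hT (fun c hc => hI c (hs2 c hc))
      (fun c hc => (Finset.mem_filter.mp hc).2)
    calc (s2.card : ℝ) ≤ (D : ℝ) ^ 8 * (NK s2 (fun c => (c.A1, c.y * c.d)) : ℕ) := by
          exact_mod_cast h1
      _ ≤ _ := by gcongr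
  have c3 : (s3.card : ℝ) ≤ (D : ℝ) ^ 8 * ∑ a ∈ I, (T a + 1) := by
    have h1 := count_zd hD s3 (fun c hc => hs c (hs3 c hc))
    have h2 := NK_pair s3 Conf.A1 (fun c => c.z * c.d) I T hT (fun c hc => hI c (hs3 c hc))
      (fun c hc => (Finset.mem_filter.mp hc).2)
    calc (s3.card : ℝ) ≤ (D : ℝ) ^ 8 * (NK s3 (fun c => (c.A1, c.z * c.d)) : ℕ) := by
          exact_mod_cast h1
      _ ≤ _ := by gcongr
  have : (s.card : ℝ) ≤ s1.card + s2.card + s3.card := by exact_mod_cast hcard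
  linarith

/-- The same with the roles of `A1` and `A2` exchanged. -/
lemma count_pairs' (hD : ∀ K : ℕ, 0 < K → K ≤ Q ^ 20 → K.divisors.card ≤ D) (s : Finset Conf)
    (hs : ∀ c ∈ s, Valid m n Q c) (I : Finset ℕ) (T : ℕ → ℝ) (hT : ∀ a ∈ I, 0 ≤ T a)
    (hI : ∀ c ∈ s, c.A2 ∈ I)
    (hj : ∀ c ∈ s, ((c.p * c.q : ℕ) : ℝ) ≤ T c.A2 ∨ ((c.p * c.s : ℕ) : ℝ) ≤ T c.A2 ∨
      ((c.q * c.s : ℕ) : ℝ) ≤ T c.A2) :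
    (s.card : ℝ) ≤ 3 * (D : ℝ) ^ 8 * ∑ a ∈ I, (T a + 1) := by
  classical
  have hinj : Function.Injective Conf.swap1 := by
    intro a b h
    have := congrArg Conf.swap1 h
    simpa [Conf.swap1_swap1] using this
  have h1 := count_pairs hD (s.image Conf.swap1) (fun c hc => by
    obtain ⟨c', hc', rfl⟩ := Finset.mem_image.mp hc
    exact (hs c' hc').swap1) I T hT (fun c hc => by
    obtain ⟨c', hc', rfl⟩ := Finset.mem_image.mp hc
    exact hI c' hc') (fun c hc => by
    obtain ⟨c', hc', rfl⟩ := Finset.mem_image.mp hc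
    exact hj c' hc')
  rwa [Finset.card_image_of_injective _ hinj] at h1

lemma count_e' (hD : ∀ K : ℕ, 0 < K → K ≤ Q ^ 20 → K.divisors.card ≤ D) (s : Finset Conf)
    (hs : ∀ c ∈ s, Valid m n Q c) (I : Finset ℕ) (T : ℕ → ℝ) (hT : ∀ a ∈ I, 0 ≤ T a)
    (hI : ∀ c ∈ s, c.A1 ∈ I)
    (hj : ∀ c ∈ s, ((c.e / (m * c.A1 - n) : ℕ) : ℝ) ≤ T c.A1) :
    (s.card : ℝ) ≤ (D : ℝ) ^ 8 * ∑ a ∈ I, (T a + 1) := by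
  have h1 := count_e hD s hs
  have h2 := NK_pair s Conf.A1 (fun c => c.e / (m * c.A1 - n)) I T hT hI hj
  calc (s.card : ℝ) ≤ (D : ℝ) ^ 8 * (NK s (fun c => (c.A1, c.e / (m * c.A1 - n))) : ℕ) := by
        exact_mod_cast h1
    _ ≤ _ := by gcongr

lemma count_B' (hD : ∀ K : ℕ, 0 < K → K ≤ Q ^ 20 → K.divisors.card ≤ D) (s : Finset Conf)
    (hs : ∀ c ∈ s, Valid m n Q c) (X J Z W : ℝ) (hX : 0 ≤ X) (hJ : 0 ≤ J) (hZ : 0 ≤ Z) (hW : 0 ≤ W)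
    (h1 : ∀ c ∈ s, (c.x : ℝ) ≤ X) (h2 : ∀ c ∈ s, ((c.f * c.p : ℕ) : ℝ) ≤ J)
    (h3 : ∀ c ∈ s, (c.z : ℝ) ≤ Z) (h4 : ∀ c ∈ s, ((c.g * c.d : ℕ) : ℝ) ≤ W) :
    (s.card : ℝ) ≤ (D : ℝ) ^ 6 * (X * J * (Z * W)) := by
  have e1 := count_B hD s hs
  have e2 := NK_box s (fun c => c.x) (fun c => c.f * c.p) (fun c => c.z) (fun c => c.g * c.d)
    ⌊X⌋₊ ⌊J⌋₊ ⌊Z⌋₊ ⌊W⌋₊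
    (fun c hc => ⟨(hs c hc).px, Nat.le_floor (h1 c hc)⟩)
    (fun c hc => ⟨Nat.mul_pos (hs c hc).pf (hs c hc).pp, Nat.le_floor (h2 c hc)⟩)
    (fun c hc => ⟨(hs c hc).pz, Nat.le_floor (h3 c hc)⟩)
    (fun c hc => ⟨Nat.mul_pos (hs c hc).pg (hs c hc).pd, Nat.le_floor (h4 c hc)⟩)
  have e3 := e1.trans (Nat.mul_le_mul_left _ e2)
  calc (s.card : ℝ) ≤ (D : ℝ) ^ 6 * (⌊X⌋₊ * ⌊J⌋₊ * (⌊Z⌋₊ * ⌊W⌋₊)) := by exact_mod_cast e3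
    _ ≤ _ := by
      have := Nat.floor_le hX; have := Nat.floor_le hJ; have := Nat.floor_le hZ
      have := Nat.floor_le hW
      gcongr

end CountB

lemma coprime_mul_add {u v : ℕ} (h : Nat.Coprime u v) : Nat.Coprime (u * v) (u + v) := by
  apply Nat.Coprime.mul_left
  · simpa using h
  · simpa using h.symm

lemma exists_split {u v n a b : ℕ} (hu : 0 < u) (h : u * v ∣ n * (a * b)) :
    ∃ u0 v0 p q y z, u = u0 * p * y ∧ v = v0 * q * z ∧ u0 * v0 ∣ n ∧ p * q ∣ a ∧ y * z ∣ b := by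
  obtain ⟨D0, D12, h0, h12, e1⟩ := exists_dvd_and_dvd_of_dvd_mul h
  obtain ⟨D1, D2, h1, h2, rfl⟩ := exists_dvd_and_dvd_of_dvd_mul h12
  have h3 : u ∣ D0 * (D1 * D2) := ⟨v, e1.symm⟩
  obtain ⟨u0, w, hu0, hw, rfl⟩ := exists_dvd_and_dvd_of_dvd_mul h3
  obtain ⟨p, y, hp, hy, rfl⟩ := exists_dvd_and_dvd_of_dvd_mul hw
  obtain ⟨v0, rfl⟩ := hu0
  obtain ⟨q, rfl⟩ := hp
  obtain ⟨z, rfl⟩ := hy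
  refine ⟨u0, v0, p, q, y, z, by ring, ?_, h0, h1, h2⟩
  apply Nat.eq_of_mul_eq_mul_left hu
  rw [e1]; ring

lemma pow_aux {n : ℕ} (hn : 1 ≤ n) : n ≤ n ^ 4 ∧ n ^ 2 ≤ n ^ 4 ∧ n ^ 3 ≤ n ^ 4 :=
  ⟨Nat.le_self_pow (by norm_num) n, Nat.pow_le_pow_right hn (by norm_num),
    Nat.pow_le_pow_right hn (by norm_num)⟩

set_option maxHeartbeats 1600000 in
/-- A solution in four unit fractions gives a valid configuration. -/
lemma exists_conf {m n a1 a2 a3 a4 : ℕ} (hm : 0 < m) (hn : 0 < n) (p1 : 0 < a1)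
    (h12 : a1 ≤ a2) (h23 : a2 ≤ a3) (h34 : a3 ≤ a4)
    (heq : n * (a2 * a3 * a4 + a1 * a3 * a4 + a1 * a2 * a4 + a1 * a2 * a3) =
      m * (a1 * a2 * a3 * a4)) :
    ∃ (c : Conf) (C : ℕ), Valid m n (96 * n ^ 4) c ∧ c.A1 = a1 ∧ c.A2 = a2 ∧
      m * a1 ≤ 4 * n ∧ a2 * (m * a1 - n) ≤ 3 * n * a1 ∧
      a3 = c.u0 * c.p * c.y * C ∧ a4 = c.v0 * c.q * c.z * C ∧
      c.e * C = c.l * (c.f * c.s) * (c.g * c.d) * (c.u0 * c.p * c.y + c.v0 * c.q * c.z) := by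
  have p2 : 0 < a2 := by omega
  have p3 : 0 < a3 := by omega
  have p4 : 0 < a4 := by omega
  have hlt : n * a1 + n * a2 < m * a1 * a2 := by
    by_contra hc
    have h1 := Nat.mul_le_mul_right (a3 * a4) (not_lt.mp hc)
    have h2 : 0 < n * (a1 * a2 * a3) := by positivity
    have h3 : 0 < n * (a1 * a2 * a4) := by positivity
    nlinarith
  obtain ⟨e, he⟩ := Nat.exists_eq_add_of_lt hlt
  obtain ⟨e', rfl⟩ : ∃ e', e' = e + 1 := ⟨_, rfl⟩
  obtain ⟨E, hE⟩ : ∃ E, E = e + 1 := ⟨_, rfl⟩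
  have pE : 0 < E := by omega
  have hE1 : E + n * a1 + n * a2 = m * a1 * a2 := by omega
  clear he hE
  have hE2 : E * (a3 * a4) = n * (a1 * a2) * (a3 + a4) := by
    have : (E + n * a1 + n * a2) * (a3 * a4) = m * a1 * a2 * (a3 * a4) := by rw [hE1]
    nlinarith
  have b1 : m * a1 ≤ 4 * n := by
    have h1 : m * (a1 * a2 * a3 * a4) ≤ 4 * n * (a2 * a3 * a4) := by
      rw [← heq]
      have t1 : a1 * a3 * a4 ≤ a2 * a3 * a4 := by gcongr
      have t2 : a1 * a2 * a4 ≤ a2 * a3 * a4 := by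
        calc a1 * a2 * a4 = a2 * a1 * a4 := by ring
          _ ≤ _ := by gcongr; omega
      have t3 : a1 * a2 * a3 ≤ a2 * a3 * a4 := by
        calc a1 * a2 * a3 = a2 * a3 * a1 := by ring
          _ ≤ _ := by gcongr; omega
      nlinarith
    have h2 : 0 < a2 * a3 * a4 := by positivity
    refine Nat.le_of_mul_le_mul_right ?_ h2
    calc _ = m * (a1 * a2 * a3 * a4) := by ring
      _ ≤ _ := h1
  have hlt1 : n < m * a1 := by
    have h1 : n * a2 < m * a1 * a2 := by nlinarith [Nat.zero_le (n * a1)]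
    exact Nat.lt_of_mul_lt_mul_right h1
  have b2 : a2 * (m * a1 - n) ≤ 3 * n * a1 := by
    obtain ⟨r, hr⟩ := Nat.exists_eq_add_of_le hlt1.le
    have hr' : m * a1 - n = r := by omega
    rw [hr']
    have h2 : 0 < a3 * a4 := by positivity
    refine Nat.le_of_mul_le_mul_right ?_ h2
    have t1 : a1 * a2 * a4 ≤ a1 * a3 * a4 := by gcongr
    have t2 : a1 * a2 * a3 ≤ a1 * a3 * a4 := by
      calc a1 * a2 * a3 = a1 * a3 * a2 := by ring
        _ ≤ _ := by gcongr; omega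
    have t3 : m * (a1 * a2 * a3 * a4) = (n + r) * (a2 * a3 * a4) := by
      rw [← hr]; ring
    nlinarith
  have hm4 : m ≤ 4 * n := le_trans (Nat.le_mul_of_pos_right m p1) b1
  have ha1 : a1 ≤ 4 * n := le_trans (Nat.le_mul_of_pos_left a1 hm) b1
  have ha2 : a2 ≤ 12 * n ^ 2 := by
    calc a2 ≤ a2 * (m * a1 - n) := Nat.le_mul_of_pos_right _ (by omega)
      _ ≤ 3 * n * a1 := b2
      _ ≤ 3 * n * (4 * n) := by gcongr
      _ = _ := by ring
  obtain ⟨u, v, huv, hu, hv⟩ := Nat.exists_coprime a3 a4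
  obtain ⟨C, hC⟩ : ∃ C, C = a3.gcd a4 := ⟨_, rfl⟩
  rw [← hC] at hu hv
  have pu : 0 < u := by rw [hu] at p3; exact Nat.pos_of_mul_pos_right p3
  have pv : 0 < v := by rw [hv] at p4; exact Nat.pos_of_mul_pos_right p4
  have pC : 0 < C := by rw [hu] at p3; exact Nat.pos_of_mul_pos_left p3
  have hE3 : E * C * (u * v) = n * (a1 * a2) * (u + v) := by
    apply Nat.eq_of_mul_eq_mul_right pC
    rw [hu, hv] at hE2
    calc _ = E * (u * C * (v * C)) := by ring
      _ = _ := by rw [hE2]; ring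
  have hdv : u * v ∣ n * (a1 * a2) :=
    (coprime_mul_add huv).dvd_of_dvd_mul_right ⟨E * C, by rw [← hE3]; ring⟩
  obtain ⟨u0, v0, p, q, y, z, hu', hv', ⟨l, hl⟩, ⟨S, hS⟩, ⟨G, hG⟩⟩ := exists_split pu hdv
  have pu0 : 0 < u0 := by
    rcases Nat.eq_zero_or_pos u0 with h | h
    · simp [h] at hu'; omega
    · exact h
  have pp : 0 < p := by
    rcases Nat.eq_zero_or_pos p with h | h
    · simp [h] at hu'; omega
    · exact h
  have py : 0 < y := by
    rcases Nat.eq_zero_or_pos y with h | h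
    · simp [h] at hu'; omega
    · exact h
  have pv0 : 0 < v0 := by
    rcases Nat.eq_zero_or_pos v0 with h | h
    · simp [h] at hv'; omega
    · exact h
  have pq : 0 < q := by
    rcases Nat.eq_zero_or_pos q with h | h
    · simp [h] at hv'; omega
    · exact h
  have pz : 0 < z := by
    rcases Nat.eq_zero_or_pos z with h | h
    · simp [h] at hv'; omega
    · exact h
  have pl : 0 < l := by
    rcases Nat.eq_zero_or_pos l with h | h
    · simp [h] at hl; omega
    · exact h
  have pS : 0 < S := by
    rcases Nat.eq_zero_or_pos S with h | h
    · simp [h] at hS; omega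
    · exact h
  have pG : 0 < G := by
    rcases Nat.eq_zero_or_pos G with h | h
    · simp [h] at hG; omega
    · exact h
  have hE4 : E * C = l * S * G * (u + v) := by
    apply Nat.eq_of_mul_eq_mul_right (Nat.mul_pos pu pv)
    rw [hE3, hl, hS, hG, hu', hv']; ring
  obtain ⟨e1, d, ced, hge, hgd⟩ := Nat.exists_coprime E G
  obtain ⟨g, hg⟩ : ∃ g, g = E.gcd G := ⟨_, rfl⟩
  rw [← hg] at hge hgd
  have pg : 0 < g := by rw [hge] at pE; exact Nat.pos_of_mul_pos_left pE
  have pd : 0 < d := by rw [hgd] at pG; exact Nat.pos_of_mul_pos_right pG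
  have pe1 : 0 < e1 := by rw [hge] at pE; exact Nat.pos_of_mul_pos_right pE
  obtain ⟨e2, s, ces, hfe, hfs⟩ := Nat.exists_coprime e1 S
  obtain ⟨f, hf⟩ : ∃ f, f = e1.gcd S := ⟨_, rfl⟩
  rw [← hf] at hfe hfs
  have pf : 0 < f := by rw [hfe] at pe1; exact Nat.pos_of_mul_pos_left pe1
  have ps : 0 < s := by rw [hfs] at pS; exact Nat.pos_of_mul_pos_right pS
  have pe2 : 0 < e2 := by rw [hfe] at pe1; exact Nat.pos_of_mul_pos_right pe1
  have ced2 : Nat.Coprime e2 d := Nat.Coprime.coprime_dvd_left ⟨f, hfe⟩ ced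
  have hE5 : e2 * C = l * (u + v) * (d * s) := by
    apply Nat.eq_of_mul_eq_mul_right (Nat.mul_pos pf pg)
    calc _ = E * C := by rw [hge, hfe]; ring
      _ = _ := by rw [hE4, hgd, hfs]; ring
  have hdv2 : e2 ∣ l * (u + v) :=
    (ced2.mul_right ces).dvd_of_dvd_mul_right ⟨C, hE5.symm⟩
  obtain ⟨x, hx⟩ := hdv2
  have px : 0 < x := by
    rcases Nat.eq_zero_or_pos x with h | h
    · have : 0 < l * (u + v) := by positivity
      rw [h] at hx; omega
    · exact h
  have hA1 : p * q * (f * s) = a1 := by rw [hS, hfs]; ring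
  have hA2 : y * z * (g * d) = a2 := by rw [hG, hgd]; ring
  have hn2 : 1 ≤ n := hn
  have dvg : g ∣ n * a1 := by
    have h1 : g ∣ E + n * a1 + n * a2 := by
      rw [hE1]; exact ⟨m * a1 * (y * z * d), by rw [← hA2]; ring⟩
    have h2 : g ∣ E := ⟨e1, by rw [hge]; ring⟩
    have h3 : g ∣ n * a2 := ⟨n * (y * z * d), by rw [← hA2]; ring⟩
    have h4 := (Nat.dvd_add_left h3).mp h1
    exact (Nat.dvd_add_right h2).mp h4
  have dvf : f ∣ n * a2 := by
    have h1 : f ∣ E + n * a1 + n * a2 := by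
      rw [hE1]; exact ⟨m * (p * q * s) * a2, by rw [← hA1]; ring⟩
    have h2 : f ∣ E := ⟨e2 * g, by rw [hge, hfe]; ring⟩
    have h3 : f ∣ n * a1 := ⟨n * (p * q * s), by rw [← hA1]; ring⟩
    exact (Nat.dvd_add_right (Nat.dvd_add h2 h3)).mp h1
  obtain ⟨w1, w2, w3⟩ := pow_aux hn2
  have q1 : n ≤ 96 * n ^ 4 := by omega
  have q2 : 12 * n ^ 2 ≤ 96 * n ^ 4 := by omega
  have q3 : 4 * n ≤ 96 * n ^ 4 := by omega
  have hbx : x ≤ 96 * n ^ 4 := by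
    have y1 : l * u0 ≤ n := by
      rw [hl]; calc l * u0 = u0 * 1 * l := by ring
        _ ≤ _ := by gcongr; omega
    have y2 : l * v0 ≤ n := by
      rw [hl]; calc l * v0 = 1 * v0 * l := by ring
        _ ≤ _ := by gcongr; omega
    have y3 : p ≤ 4 * n := (Nat.le_of_dvd p1 ⟨q * (f * s), by rw [← hA1]; ring⟩).trans ha1
    have y4 : q ≤ 4 * n := (Nat.le_of_dvd p1 ⟨p * (f * s), by rw [← hA1]; ring⟩).trans ha1
    have y5 : y ≤ 12 * n ^ 2 := (Nat.le_of_dvd p2 ⟨z * (g * d), by rw [← hA2]; ring⟩).trans ha2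
    have y6 : z ≤ 12 * n ^ 2 := (Nat.le_of_dvd p2 ⟨y * (g * d), by rw [← hA2]; ring⟩).trans ha2
    calc x ≤ e2 * x := Nat.le_mul_of_pos_left _ pe2
      _ = (l * u0) * p * y + (l * v0) * q * z := by rw [← hx, hu', hv']; ring
      _ ≤ n * (4 * n) * (12 * n ^ 2) + n * (4 * n) * (12 * n ^ 2) := by gcongr
      _ = _ := by ring
  have hbE : E ≤ 96 * n ^ 4 := by
    calc E ≤ m * a1 * a2 := by omega
      _ ≤ 4 * n * (12 * n ^ 2) := by gcongr
      _ = 48 * n ^ 3 := by ring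
      _ ≤ 96 * n ^ 4 := by omega
  refine ⟨⟨u0, v0, l, p, q, f, s, y, z, g, d, x, E⟩, C, ?_, hA1, hA2, b1, b2, ?_, ?_, ?_⟩
  · have A1e : Conf.A1 ⟨u0, v0, l, p, q, f, s, y, z, g, d, x, E⟩ = a1 := hA1
    have A2e : Conf.A2 ⟨u0, v0, l, p, q, f, s, y, z, g, d, x, E⟩ = a2 := hA2
    have c1 : Nat.Coprime q y := by
      have h1 : Nat.Coprime y v := Nat.Coprime.coprime_dvd_left ⟨u0 * p, by rw [hu']; ring⟩ huv
      exact (Nat.Coprime.coprime_dvd_right ⟨v0 * z, by rw [hv']; ring⟩ h1).symm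
    have c2 : Nat.Coprime p z := by
      have h1 : Nat.Coprime p v := Nat.Coprime.coprime_dvd_left ⟨u0 * y, by rw [hu']; ring⟩ huv
      exact Nat.Coprime.coprime_dvd_right ⟨v0 * q, by rw [hv']; ring⟩ h1
    have dn : ∀ w, w ∣ n → w ≤ 96 * n ^ 4 := fun w hw => (Nat.le_of_dvd hn hw).trans q1
    have d1 : ∀ w, w ∣ a1 → w ≤ 96 * n ^ 4 := fun w hw => (Nat.le_of_dvd p1 hw).trans (ha1.trans q3)
    have d2 : ∀ w, w ∣ a2 → w ≤ 96 * n ^ 4 := fun w hw => (Nat.le_of_dvd p2 hw).trans (ha2.trans q2)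
    refine ⟨hl.symm, by rw [A1e, A2e]; exact hE1, by rw [A1e]; exact dvg, by rw [A2e]; exact dvf,
      ?_, c1, c2, pu0, pv0, pl, pp, pq, pf, ps, py, pz, pg, pd, px, pE, hm, hn,
      dn _ ⟨v0 * l, by simp only []; rw [hl]; ring⟩, dn _ ⟨u0 * l, by simp only []; rw [hl]; ring⟩,
      dn _ ⟨u0 * v0, by simp only []; rw [hl]; ring⟩,
      d1 _ ⟨q * (f * s), by simp only []; rw [← hA1]; ring⟩,
      d1 _ ⟨p * (f * s), by simp only []; rw [← hA1]; ring⟩,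
      d1 _ ⟨p * q * s, by simp only []; rw [← hA1]; ring⟩,
      d1 _ ⟨p * q * f, by simp only []; rw [← hA1]; ring⟩,
      d2 _ ⟨z * (g * d), by simp only []; rw [← hA2]; ring⟩,
      d2 _ ⟨y * (g * d), by simp only []; rw [← hA2]; ring⟩,
      d2 _ ⟨y * z * d, by simp only []; rw [← hA2]; ring⟩,
      d2 _ ⟨y * z * g, by simp only []; rw [← hA2]; ring⟩,
      hbx, hbE, hm4.trans q3, q1, by rw [A1e]; exact ha1.trans q3, by rw [A2e]; exact ha2.trans q2, ?_⟩
    · change x * E = f * g * l * (u0 * p * y + v0 * q * z)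
      rw [← hu', ← hv', mul_assoc (f * g), hx, hge, hfe]; ring
    · omega
  · change a3 = u0 * p * y * C
    rw [hu, hu']
  · change a4 = v0 * q * z * C
    rw [hv, hv']
  · change E * C = l * (f * s) * (g * d) * (u0 * p * y + v0 * q * z)
    rw [hE4, ← hu', ← hv', hfs, hgd]; ring

lemma sum_inv_inj (I : Finset ℕ) (φ : ℕ → ℕ) (N : ℕ) (hφ : Set.InjOn φ I)
    (hN : ∀ a ∈ I, 1 ≤ φ a ∧ φ a ≤ N) :
    ∑ a ∈ I, (1 : ℝ) / φ a ≤ ∑ i ∈ Icc 1 N, (1 : ℝ) / i := by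
  rw [← Finset.sum_image (f := fun i : ℕ => (1 : ℝ) / i) hφ]
  apply Finset.sum_le_sum_of_subset_of_nonneg
  · intro i hi
    obtain ⟨a, ha, rfl⟩ := Finset.mem_image.mp hi
    exact Finset.mem_Icc.mpr (hN a ha)
  · intros; positivity

lemma inj_sub {m n : ℕ} (hm : 0 < m) {a b : ℕ} (ha : n < m * a) (hb : n < m * b)
    (h : (m * a - n) / m = (m * b - n) / m) : a = b := by
  have key : ∀ a b : ℕ, n < m * a → a < b → (m * a - n) / m < (m * b - n) / m := by
    intro a b ha hab
    have h1 : m * a - n + m ≤ m * b - n := by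
      have : m * (a + 1) ≤ m * b := Nat.mul_le_mul_left m hab
      rw [mul_add] at this; omega
    have h2 := Nat.div_le_div_right (c := m) h1
    rw [Nat.add_div_right _ hm] at h2
    omega
  rcases lt_trichotomy a b with h1 | h1 | h1
  · have := key a b ha h1; omega
  · exact h1
  · have := key b a hb h1; omega

lemma three_pairs {y z d T B : ℝ} (hy : 0 < y) (hz : 0 < z) (hd : 0 < d) (hT : 0 ≤ T)
    (hB : y * z * d ≤ B) (h : B ^ 2 ≤ T ^ 3) : y * z ≤ T ∨ y * d ≤ T ∨ z * d ≤ T := by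
  by_contra hc
  push Not at hc
  obtain ⟨h1, h2, h3⟩ := hc
  have h4 : T * T ≤ (y * z) * (y * d) := by gcongr
  have h5 : T * T * T < (y * z) * (y * d) * (z * d) := by
    apply mul_lt_mul_of_le_of_lt_of_nonneg_of_pos h4 h3 hT (by positivity)
  have h6 : (y * z * d) ^ 2 ≤ B ^ 2 := by gcongr
  nlinarith

section Main4

variable {m n Q D : ℕ}

lemma case1 (hD : ∀ K : ℕ, 0 < K → K ≤ Q ^ 20 → K.divisors.card ≤ D) (s : Finset Conf)
    (hs : ∀ c ∈ s, Valid m n Q c) (h4 : ∀ c ∈ s, m * c.A1 ≤ 4 * n)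
    (hm : 0 < m)
    (t H : ℝ) (ht : 1 ≤ t) (htn : t ^ 8 = n)
    (hH : ∑ i ∈ (Icc 1 (12 * n ^ 2) : Finset ℕ), (1 : ℝ) / i ≤ H)
    (hA2 : ∀ c ∈ s, (c.A2 : ℝ) * (m * c.A1 - n : ℕ) * m ≤ 12 * t ^ 16)
    (h7 : ∀ c ∈ s, ((m * c.A1 - n : ℕ) : ℝ) ≤ t ^ 7 ∨ m * c.A1 - n < m) :
    (s.card : ℝ) ≤ 3 * (D : ℝ) ^ 8 * (6 * t ^ 13 / m * H + 7 * t ^ 6 * (t ^ 7 / m + 1)) := by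
  classical
  have ht0 : 0 < t := by linarith
  have hmr : (0 : ℝ) < m := by exact_mod_cast hm
  have hn : 1 ≤ n := by
    have : (1 : ℝ) ≤ n := by rw [← htn]; exact one_le_pow₀ ht
    exact_mod_cast this
  set I := (Finset.range (4 * n + 1)).filter (fun a => n < m * a ∧ m * a ≤ 4 * n ∧
    (((m * a - n : ℕ) : ℝ) ≤ t ^ 7 ∨ m * a - n < m)) with hI
  set T : ℕ → ℝ := fun a => 6 * (t ^ 13 / (m * (m * a - n : ℕ)) + t ^ 6) with hT
  have hmem : ∀ c ∈ s, c.A1 ∈ I := by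
    intro c hc
    rw [hI, Finset.mem_filter, Finset.mem_range]
    refine ⟨?_, (hs c hc).n_lt, h4 c hc, h7 c hc⟩
    have := h4 c hc
    have := Nat.le_mul_of_pos_left c.A1 hm
    omega
  have key := count_pairs hD s hs I T (fun a _ => by positivity) hmem (by
    intro c hc
    have hv := hs c hc
    have hm1 : (0 : ℝ) < (m * c.A1 - n : ℕ) := by
      have := hv.n_lt
      exact_mod_cast Nat.sub_pos_of_lt this
    have hy : (0 : ℝ) < c.y := by exact_mod_cast hv.py
    have hz : (0 : ℝ) < c.z := by exact_mod_cast hv.pz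
    have hd : (0 : ℝ) < c.d := by exact_mod_cast hv.pd
    have hB : (c.y : ℝ) * c.z * c.d ≤ 12 * t ^ 16 / (m * (m * c.A1 - n : ℕ)) := by
      rw [le_div_iff₀ (by positivity)]
      refine le_trans ?_ (hA2 c hc)
      have : (c.y : ℝ) * c.z * c.d ≤ c.A2 := by
        have : c.y * c.z * c.d ≤ c.A2 := by
          unfold Conf.A2
          exact Nat.mul_le_mul_left _ (Nat.le_mul_of_pos_left _ hv.pg)
        exact_mod_cast this
      calc _ = (c.y : ℝ) * c.z * c.d * ((m * c.A1 - n : ℕ) * m) := by ring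
        _ ≤ c.A2 * ((m * c.A1 - n : ℕ) * m) := by gcongr
        _ = _ := by ring
    have h3 := three_pairs hy hz hd (T := T c.A1) (by positivity) hB (by
      simp only [hT]
      set α := t ^ 13 / (m * (m * c.A1 - n : ℕ)) with hα
      have hα0 : 0 < α := by positivity
      have e1 : (12 * t ^ 16 / (m * (m * c.A1 - n : ℕ))) ^ 2 = 144 * (α ^ 2 * t ^ 6) := by
        rw [hα]; field_simp; ring
      rw [e1]
      have hb : 0 < t ^ 6 := by positivity
      have : (6 * (α + t ^ 6)) ^ 3 = 216 * (α ^ 3 + 3 * α ^ 2 * t ^ 6 + 3 * α * (t ^ 6) ^ 2 +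
        (t ^ 6) ^ 3) := by ring
      rw [this]
      have : 0 ≤ α ^ 3 := by positivity
      have : 0 ≤ α ^ 2 * t ^ 6 := by positivity
      have : 0 ≤ α * (t ^ 6) ^ 2 := by positivity
      have : 0 ≤ (t ^ 6) ^ 3 := by positivity
      nlinarith)
    simpa only [Nat.cast_mul] using h3)
  refine key.trans ?_
  have hcard : (I.card : ℝ) ≤ t ^ 7 / m + 1 := by
    have h1 : I.card ≤ (Finset.range (⌊t ^ 7 / m⌋₊ + 1)).card := by
      apply Finset.card_le_card_of_injOn (fun a => (m * a - n) / m)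
      · intro a ha
        rw [hI, Finset.mem_coe, Finset.mem_filter] at ha
        obtain ⟨_, _, _, h7⟩ := ha
        simp only [Finset.coe_range, Set.mem_Iio]
        rw [Nat.lt_succ_iff]
        rcases h7 with h7 | h7
        · apply Nat.le_floor
          calc (((m * a - n) / m : ℕ) : ℝ) ≤ ((m * a - n : ℕ) : ℝ) / m := Nat.cast_div_le
            _ ≤ _ := by gcongr
        · rw [Nat.div_eq_of_lt h7]; exact Nat.zero_le _
      · intro a ha b hb hab
        rw [hI, Finset.mem_coe, Finset.mem_filter] at ha hb
        exact inj_sub hm ha.2.1 hb.2.1 hab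
    rw [Finset.card_range] at h1
    have h2 : (I.card : ℝ) ≤ ⌊t ^ 7 / m⌋₊ + 1 := by exact_mod_cast h1
    have := Nat.floor_le (show 0 ≤ t ^ 7 / m by positivity)
    linarith
  have hsum : ∑ a ∈ I, (1 : ℝ) / (m * a - n : ℕ) ≤ H := by
    refine le_trans (sum_inv_inj I (fun a => m * a - n) (12 * n ^ 2) ?_ ?_) hH
    · intro a ha b hb hab
      rw [hI, Finset.mem_coe, Finset.mem_filter] at ha hb
      exact inj_sub hm ha.2.1 hb.2.1 (by simp only at hab; rw [hab])
    · intro a ha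
      rw [hI, Finset.mem_filter] at ha
      obtain ⟨_, h1, h2, _⟩ := ha
      constructor
      · omega
      · have : n ≤ n ^ 2 := Nat.le_self_pow (by norm_num) n
        omega
  have e : ∑ a ∈ I, (T a + 1) = 6 * t ^ 13 / m * ∑ a ∈ I, (1 : ℝ) / (m * a - n : ℕ) +
      I.card * (6 * t ^ 6 + 1) := by
    rw [Finset.mul_sum, ← nsmul_eq_mul, ← Finset.sum_const, ← Finset.sum_add_distrib]
    refine Finset.sum_congr rfl (fun a ha => ?_)
    rw [hI, Finset.mem_filter] at ha
    have hm1 : (0 : ℝ) < (m * a - n : ℕ) := by exact_mod_cast Nat.sub_pos_of_lt ha.2.1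
    simp only [hT]
    field_simp
    ring
  rw [e]
  have h6 : 1 ≤ t ^ 6 := one_le_pow₀ ht
  have h8 : (I.card : ℝ) * (6 * t ^ 6 + 1) ≤ 7 * t ^ 6 * (t ^ 7 / m + 1) := by
    rw [mul_comm]
    apply mul_le_mul _ hcard (by positivity) (by positivity)
    linarith
  gcongr

lemma case2_sum (hm : 0 < m)
    (t H : ℝ) (ht : 1 ≤ t) (htn : t ^ 8 = n)
    (hH : ∑ i ∈ (Icc 1 (12 * n ^ 2) : Finset ℕ), (1 : ℝ) / i ≤ H) :
    ∑ a ∈ (Finset.Icc 1 (4 * n)).filter (fun a => n < m * a ∧ m * a ≤ 4 * n ∧ m ≤ m * a - n),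
      (t ^ 13 / (m * a - n : ℕ) + 1) ≤ t ^ 13 / m * H + 4 * t ^ 9 := by
  have ht0 : 0 < t := by linarith
  have hmr : (0 : ℝ) < m := by exact_mod_cast hm
  have hn : 1 ≤ n := by
    have : (1 : ℝ) ≤ n := by rw [← htn]; exact one_le_pow₀ ht
    exact_mod_cast this
  set I := (Finset.Icc 1 (4 * n)).filter (fun a => n < m * a ∧ m * a ≤ 4 * n ∧ m ≤ m * a - n)
    with hI
  have hsum : ∑ a ∈ I, (1 : ℝ) / ((m * a - n) / m : ℕ) ≤ H := by
    refine le_trans (sum_inv_inj I (fun a => (m * a - n) / m) (12 * n ^ 2) ?_ ?_) hH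
    · intro a ha b hb hab
      rw [hI, Finset.mem_coe, Finset.mem_filter] at ha hb
      exact inj_sub hm ha.2.1 hb.2.1 hab
    · intro a ha
      rw [hI, Finset.mem_filter] at ha
      obtain ⟨_, h1, h2, h3⟩ := ha
      constructor
      · exact (Nat.one_le_div_iff hm).mpr h3
      · have : n ≤ n ^ 2 := Nat.le_self_pow (by norm_num) n
        have := Nat.div_le_self (m * a - n) m
        omega
  have hle : ∑ a ∈ I, (t ^ 13 / (m * a - n : ℕ) + 1) ≤
      ∑ a ∈ I, (t ^ 13 / m * ((1 : ℝ) / ((m * a - n) / m : ℕ)) + 1) := by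
    refine Finset.sum_le_sum (fun a ha => ?_)
    rw [hI, Finset.mem_filter] at ha
    obtain ⟨_, h1, h2, h3⟩ := ha
    have hp : 0 < (m * a - n) / m := (Nat.one_le_div_iff hm).mpr h3
    have hpr : (0 : ℝ) < ((m * a - n) / m : ℕ) := by exact_mod_cast hp
    have : (m : ℝ) * ((m * a - n) / m : ℕ) ≤ (m * a - n : ℕ) := by
      exact_mod_cast Nat.mul_div_le (m * a - n) m
    gcongr
    calc t ^ 13 / (m * a - n : ℕ) ≤ t ^ 13 / (m * ((m * a - n) / m : ℕ)) := by gcongr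
      _ = _ := by field_simp
  refine hle.trans ?_
  rw [Finset.sum_add_distrib, ← Finset.mul_sum, Finset.sum_const, nsmul_eq_mul, mul_one]
  have hcard : (I.card : ℝ) ≤ 4 * t ^ 9 := by
    have h1 : I.card ≤ 4 * n := by
      refine (Finset.card_filter_le _ _).trans ?_
      simp
    calc (I.card : ℝ) ≤ 4 * n := by exact_mod_cast h1
      _ = 4 * t ^ 8 := by rw [htn]
      _ ≤ 4 * t ^ 9 := by gcongr; norm_num
  gcongr

lemma case3_sum (hm : 0 < m)
    (t H : ℝ) (ht : 1 ≤ t) (htn : t ^ 8 = n)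
    (hH : ∑ i ∈ (Icc 1 (12 * n ^ 2) : Finset ℕ), (1 : ℝ) / i ≤ H) :
    ∑ a ∈ Finset.Icc 1 ⌊12 * t ^ 9 / m⌋₊,
      (t ^ 13 / (m * a) + 1) ≤ t ^ 13 / m * H + 12 * t ^ 9 := by
  have ht0 : 0 < t := by linarith
  have hmr : (1 : ℝ) ≤ m := by exact_mod_cast hm
  have h0 : 12 * t ^ 9 / m ≤ 12 * t ^ 9 := div_le_self (by positivity) hmr
  have hfl : ⌊12 * t ^ 9 / m⌋₊ ≤ 12 * n ^ 2 := by
    apply Nat.floor_le_of_le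
    refine h0.trans ?_
    push_cast
    rw [← htn]
    calc 12 * t ^ 9 ≤ 12 * t ^ 16 := by gcongr <;> norm_num [ht]
      _ = _ := by ring
  have e : ∑ a ∈ Finset.Icc 1 ⌊12 * t ^ 9 / m⌋₊, (t ^ 13 / (m * a) + 1) =
      t ^ 13 / m * ∑ a ∈ Finset.Icc 1 ⌊12 * t ^ 9 / m⌋₊, (1 : ℝ) / a + ⌊12 * t ^ 9 / m⌋₊ := by
    rw [Finset.sum_add_distrib, Finset.mul_sum, Finset.sum_const]
    simp only [Nat.card_Icc, Nat.add_sub_cancel, nsmul_eq_mul, mul_one]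
    congr 1
    refine Finset.sum_congr rfl (fun a ha => ?_)
    have : (0 : ℝ) < a := by exact_mod_cast (Finset.mem_Icc.mp ha).1
    field_simp
  rw [e]
  have h2 : ∑ a ∈ Finset.Icc 1 ⌊12 * t ^ 9 / m⌋₊, (1 : ℝ) / a ≤ H := by
    refine le_trans ?_ hH
    apply Finset.sum_le_sum_of_subset_of_nonneg
    · exact Finset.Icc_subset_Icc_right hfl
    · intros; positivity
  have h3 : (⌊12 * t ^ 9 / m⌋₊ : ℝ) ≤ 12 * t ^ 9 := (Nat.floor_le (by positivity)).trans h0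
  gcongr

/-- The last case, in which all the pairs are large. -/
lemma case4 (hD : ∀ K : ℕ, 0 < K → K ≤ Q ^ 20 → K.divisors.card ≤ D) (s : Finset Conf)
    (hs : ∀ c ∈ s, Valid m n Q c) (h4 : ∀ c ∈ s, m * c.A1 ≤ 4 * n)
    (hm : 0 < m)
    (t : ℝ) (ht : 1 ≤ t) (htn : t ^ 8 = n)
    (hA2 : ∀ c ∈ s, (c.A2 : ℝ) * (m * c.A1 - n : ℕ) * m ≤ 12 * t ^ 16)
    (hA2' : ∀ c ∈ s, (c.A2 : ℝ) ≤ 12 * t ^ 9 / m)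
    (hT : ∀ c ∈ s, t ^ 13 / (m * c.A1 - n : ℕ) < ((c.y * c.z : ℕ) : ℝ) ∧
      t ^ 13 / (m * c.A1 - n : ℕ) < ((c.y * c.d : ℕ) : ℝ) ∧
      t ^ 13 / (m * c.A1 - n : ℕ) < ((c.z * c.d : ℕ) : ℝ))
    (hT' : ∀ c ∈ s, t ^ 13 / (m * c.A2) < ((c.p * c.q : ℕ) : ℝ) ∧
      t ^ 13 / (m * c.A2) < ((c.p * c.s : ℕ) : ℝ) ∧
      t ^ 13 / (m * c.A2) < ((c.q * c.s : ℕ) : ℝ))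
    (he : ∀ c ∈ s, t ^ 13 < (c.e : ℝ)) :
    (s.card : ℝ) ≤ (D : ℝ) ^ 6 * (7962624 * t ^ 12 / m) := by
  have ht0 : 0 < t := by linarith
  have hmr : (1 : ℝ) ≤ m := by exact_mod_cast hm
  have hm0 : (0 : ℝ) < m := by linarith
  have main : ∀ c ∈ s, (c.x : ℝ) ≤ 1152 * t ^ 2 ∧ ((c.f * c.p : ℕ) : ℝ) ≤ 48 * t ^ 4 / m ∧
      (c.z : ℝ) ≤ 12 * t ^ 3 / m ∧ ((c.g * c.d : ℕ) : ℝ) ≤ 12 * t ^ 3 := by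
    intro c hc
    have hv := hs c hc
    have hm1 : (0 : ℝ) < (m * c.A1 - n : ℕ) := by
      exact_mod_cast Nat.sub_pos_of_lt hv.n_lt
    obtain ⟨t1, t2, t3⟩ := hT c hc
    obtain ⟨r1, r2, r3⟩ := hT' c hc
    have pA2 : (0 : ℝ) < c.A2 := by exact_mod_cast hv.pA2
    -- pairs from `A2`
    have step : ∀ w j : ℕ, w * j = c.A2 → t ^ 13 / (m * c.A1 - n : ℕ) < (j : ℝ) →
        (w : ℝ) ≤ 12 * t ^ 3 / m := by
      intro w j hwj hj
      rw [div_lt_iff₀ hm1] at hj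
      have h1 := hA2 c hc
      rw [← hwj] at h1
      push_cast at h1
      rw [le_div_iff₀ hm0]
      by_contra hcon
      push Not at hcon
      have h2 : 12 * t ^ 3 * t ^ 13 < (w : ℝ) * m * (j * (m * c.A1 - n : ℕ)) := by
        apply mul_lt_mul'' hcon hj (by positivity) (by positivity)
      nlinarith
    have step' : ∀ w j : ℕ, w * j = c.A1 → t ^ 13 / (m * c.A2) < (j : ℝ) →
        (w : ℝ) ≤ 48 * t ^ 4 / m := by
      intro w j hwj hj
      rw [div_lt_iff₀ (by positivity)] at hj
      have h1 : (m : ℝ) * c.A1 ≤ 4 * t ^ 8 := by rw [htn]; exact_mod_cast h4 c hc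
      rw [← hwj] at h1
      push_cast at h1
      have h3 := hA2' c hc
      have h2 : (w : ℝ) * t ^ 13 ≤ 48 * t ^ 4 / m * t ^ 13 := by
        calc (w : ℝ) * t ^ 13 ≤ w * (j * (m * c.A2)) := by gcongr
          _ = m * (w * j) * c.A2 := by ring
          _ ≤ (4 * t ^ 8) * (12 * t ^ 9 / m) := by gcongr
          _ = _ := by field_simp; ring
      exact le_of_mul_le_mul_right h2 (by positivity)
    have gd := step (c.g * c.d) (c.y * c.z) (by unfold Conf.A2; ring) t1
    have gz := step (c.g * c.z) (c.y * c.d) (by unfold Conf.A2; ring) t2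
    have gy := step (c.g * c.y) (c.z * c.d) (by unfold Conf.A2; ring) t3
    have fq := step' (c.f * c.q) (c.p * c.s) (by unfold Conf.A1; ring) r2
    have fp := step' (c.f * c.p) (c.q * c.s) (by unfold Conf.A1; ring) r3
    refine ⟨?_, fp, ?_, ?_⟩
    · have h1 : c.x * c.e ≤ n * (c.f * c.p * (c.g * c.y) + c.f * c.q * (c.g * c.z)) := by
        rw [hv.hx]
        have y1 : c.l * c.u0 ≤ n := by
          rw [← hv.hn]; have := hv.pv0
          calc c.l * c.u0 = c.u0 * 1 * c.l := by ring
            _ ≤ _ := by gcongr; omega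
        have y2 : c.l * c.v0 ≤ n := by
          rw [← hv.hn]; have := hv.pu0
          calc c.l * c.v0 = 1 * c.v0 * c.l := by ring
            _ ≤ _ := by gcongr; omega
        calc _ = (c.l * c.u0) * (c.f * c.p * (c.g * c.y)) +
              (c.l * c.v0) * (c.f * c.q * (c.g * c.z)) := by ring
          _ ≤ n * (c.f * c.p * (c.g * c.y)) + n * (c.f * c.q * (c.g * c.z)) := by gcongr
          _ = _ := by ring
      have h2 : (c.x : ℝ) * c.e ≤ t ^ 8 * (((c.f * c.p : ℕ) : ℝ) * ((c.g * c.y : ℕ) : ℝ) +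
          ((c.f * c.q : ℕ) : ℝ) * ((c.g * c.z : ℕ) : ℝ)) := by
        rw [htn]; exact_mod_cast h1
      have h3 : (c.x : ℝ) * t ^ 13 ≤ 1152 * t ^ 2 * t ^ 13 := by
        calc (c.x : ℝ) * t ^ 13 ≤ c.x * c.e := by have := he c hc; gcongr
          _ ≤ _ := h2
          _ ≤ t ^ 8 * (48 * t ^ 4 / m * (12 * t ^ 3 / m) + 48 * t ^ 4 / m * (12 * t ^ 3 / m)) := by
              gcongr
          _ ≤ t ^ 8 * (48 * t ^ 4 / 1 * (12 * t ^ 3 / 1) + 48 * t ^ 4 / 1 * (12 * t ^ 3 / 1)) := by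
              gcongr
          _ = _ := by ring
      exact le_of_mul_le_mul_right h3 (by positivity)
    · refine le_trans ?_ gz
      exact_mod_cast Nat.le_mul_of_pos_left _ hv.pg
    · exact gd.trans (div_le_self (by positivity) hmr)
  have := count_B' hD s hs (1152 * t ^ 2) (48 * t ^ 4 / m) (12 * t ^ 3 / m) (12 * t ^ 3)
    (by positivity) (by positivity) (by positivity) (by positivity)
    (fun c hc => (main c hc).1) (fun c hc => (main c hc).2.1) (fun c hc => (main c hc).2.2.1)
    (fun c hc => (main c hc).2.2.2)
  refine this.trans ?_
  gcongr
  calc _ = 7962624 * t ^ 12 / m / m := by ring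
    _ ≤ _ := div_le_self (by positivity) hmr

end Main4

section Main4

variable {m n Q D : ℕ}

lemma main4 (hD : ∀ K : ℕ, 0 < K → K ≤ Q ^ 20 → K.divisors.card ≤ D) (s : Finset Conf)
    (hs : ∀ c ∈ s, Valid m n Q c) (h4 : ∀ c ∈ s, m * c.A1 ≤ 4 * n)
    (h3 : ∀ c ∈ s, c.A2 * (m * c.A1 - n) ≤ 3 * n * c.A1)
    (hm : 0 < m) (hQ : 0 < Q)
    (t H : ℝ) (ht : 1 ≤ t) (htn : t ^ 8 = n) (hH1 : 1 ≤ H)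
    (hH : ∑ i ∈ (Icc 1 (12 * n ^ 2) : Finset ℕ), (1 : ℝ) / i ≤ H) :
    (s.card : ℝ) ≤ 10 ^ 7 * (D : ℝ) ^ 8 * H * (t ^ 13 / m + t ^ 9) := by
  classical
  have ht0 : 0 < t := by linarith
  have hmr : (1 : ℝ) ≤ m := by exact_mod_cast hm
  have hm0 : (0 : ℝ) < m := by linarith
  have hD1 : (1 : ℝ) ≤ D := by
    have := hD 1 one_pos (Nat.one_le_pow _ _ hQ)
    simp at this
    exact_mod_cast this
  have hA2 : ∀ c ∈ s, (c.A2 : ℝ) * (m * c.A1 - n : ℕ) * m ≤ 12 * t ^ 16 := by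
    intro c hc
    have h1 : c.A2 * (m * c.A1 - n) * m ≤ 12 * n ^ 2 := by
      calc _ ≤ 3 * n * c.A1 * m := Nat.mul_le_mul_right _ (h3 c hc)
        _ = 3 * n * (m * c.A1) := by ring
        _ ≤ 3 * n * (4 * n) := Nat.mul_le_mul_left _ (h4 c hc)
        _ = _ := by ring
    calc _ ≤ (12 : ℝ) * n ^ 2 := by exact_mod_cast h1
      _ = _ := by rw [← htn]; ring
  set s1 := s.filter (fun c => ((m * c.A1 - n : ℕ) : ℝ) ≤ t ^ 7 ∨ m * c.A1 - n < m) with hs1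
  set s' := s.filter (fun c => ¬ (((m * c.A1 - n : ℕ) : ℝ) ≤ t ^ 7 ∨ m * c.A1 - n < m)) with hs'
  set s2 := s'.filter (fun c => ((c.y * c.z : ℕ) : ℝ) ≤ t ^ 13 / (m * c.A1 - n : ℕ) ∨
    ((c.y * c.d : ℕ) : ℝ) ≤ t ^ 13 / (m * c.A1 - n : ℕ) ∨
    ((c.z * c.d : ℕ) : ℝ) ≤ t ^ 13 / (m * c.A1 - n : ℕ)) with hs2
  set s3 := s'.filter (fun c => (c.e : ℝ) ≤ t ^ 13) with hs3
  set s4 := s'.filter (fun c => ((c.p * c.q : ℕ) : ℝ) ≤ t ^ 13 / (m * c.A2) ∨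
    ((c.p * c.s : ℕ) : ℝ) ≤ t ^ 13 / (m * c.A2) ∨
    ((c.q * c.s : ℕ) : ℝ) ≤ t ^ 13 / (m * c.A2)) with hs4
  set s5 := s' \ (s2 ∪ s3 ∪ s4) with hs5
  have hsub' : ∀ c ∈ s', c ∈ s := fun c hc => (Finset.mem_filter.mp hc).1
  have hcov : s ⊆ s1 ∪ (s2 ∪ s3 ∪ s4 ∪ s5) := by
    intro c hc
    by_cases h1 : c ∈ s1
    · exact Finset.mem_union_left _ h1
    · have : c ∈ s' := by
        rw [hs1, Finset.mem_filter] at h1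
        rw [hs', Finset.mem_filter]; tauto
      apply Finset.mem_union_right
      by_cases h2 : c ∈ s2 ∪ s3 ∪ s4
      · exact Finset.mem_union_left _ h2
      · exact Finset.mem_union_right _ (Finset.mem_sdiff.mpr ⟨this, h2⟩)
  have hcard : (s.card : ℝ) ≤ s1.card + (s2.card + s3.card + s4.card + s5.card) := by
    have h1 := Finset.card_le_card hcov
    have h2 := Finset.card_union_le s1 (s2 ∪ s3 ∪ s4 ∪ s5)
    have h3 := Finset.card_union_le (s2 ∪ s3 ∪ s4) s5
    have h4 := Finset.card_union_le (s2 ∪ s3) s4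
    have h5 := Finset.card_union_le s2 s3
    have : s.card ≤ s1.card + (s2.card + s3.card + s4.card + s5.card) := by omega
    exact_mod_cast this
  have hbig : ∀ c ∈ s', t ^ 7 < ((m * c.A1 - n : ℕ) : ℝ) ∧ m ≤ m * c.A1 - n := by
    intro c hc
    have := (Finset.mem_filter.mp hc).2
    push Not at this
    exact this
  have hA2' : ∀ c ∈ s', (c.A2 : ℝ) ≤ 12 * t ^ 9 / m := by
    intro c hc
    have h1 := hA2 c (hsub' c hc)
    have h2 := (hbig c hc).1
    rw [le_div_iff₀ hm0]
    have h5 : (c.A2 : ℝ) * m * t ^ 7 ≤ 12 * t ^ 9 * t ^ 7 := by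
      calc (c.A2 : ℝ) * m * t ^ 7 ≤ c.A2 * m * (m * c.A1 - n : ℕ) := by gcongr
        _ = c.A2 * (m * c.A1 - n : ℕ) * m := by ring
        _ ≤ _ := h1
        _ = _ := by ring
    exact le_of_mul_le_mul_right h5 (by positivity)
  set I2 := (Finset.Icc 1 (4 * n)).filter (fun a => n < m * a ∧ m * a ≤ 4 * n ∧ m ≤ m * a - n)
    with hI2
  have hmem2 : ∀ c ∈ s', c.A1 ∈ I2 := by
    intro c hc
    have hc' := hsub' c hc
    rw [hI2, Finset.mem_filter, Finset.mem_Icc]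
    refine ⟨⟨(hs c hc').pA1, ?_⟩, (hs c hc').n_lt, h4 c hc', (hbig c hc).2⟩
    have := h4 c hc'
    have := Nat.le_mul_of_pos_left c.A1 hm
    omega
  have sum2 := case2_sum hm t H ht htn hH
  rw [← hI2] at sum2
  have sum3 := case3_sum hm t H ht htn hH
  have c1 := case1 hD s1 (fun c hc => hs c (Finset.mem_filter.mp hc).1)
    (fun c hc => h4 c (Finset.mem_filter.mp hc).1) hm t H ht htn hH
    (fun c hc => hA2 c (Finset.mem_filter.mp hc).1) (fun c hc => (Finset.mem_filter.mp hc).2)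
  have c2 := count_pairs hD s2 (fun c hc => hs c (hsub' c (Finset.mem_filter.mp hc).1)) I2
    (fun a => t ^ 13 / (m * a - n : ℕ)) (fun a _ => by positivity)
    (fun c hc => hmem2 c (Finset.mem_filter.mp hc).1) (fun c hc => (Finset.mem_filter.mp hc).2)
  have c3 := count_e' hD s3 (fun c hc => hs c (hsub' c (Finset.mem_filter.mp hc).1)) I2
    (fun a => t ^ 13 / (m * a - n : ℕ)) (fun a _ => by positivity)
    (fun c hc => hmem2 c (Finset.mem_filter.mp hc).1) (fun c hc => by
      have h1 := (Finset.mem_filter.mp hc).2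
      refine Nat.cast_div_le.trans ?_
      gcongr)
  have c4 := count_pairs' hD s4 (fun c hc => hs c (hsub' c (Finset.mem_filter.mp hc).1))
    (Finset.Icc 1 ⌊12 * t ^ 9 / m⌋₊)
    (fun a => t ^ 13 / (m * a)) (fun a _ => by positivity)
    (fun c hc => Finset.mem_Icc.mpr ⟨(hs c (hsub' c (Finset.mem_filter.mp hc).1)).pA2,
      Nat.le_floor (hA2' c (Finset.mem_filter.mp hc).1)⟩)
    (fun c hc => (Finset.mem_filter.mp hc).2)
  have h5s : ∀ c ∈ s5, c ∈ s' := fun c hc => (Finset.mem_sdiff.mp hc).1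
  have h5n : ∀ c ∈ s5, c ∉ s2 ∧ c ∉ s3 ∧ c ∉ s4 := fun c hc => by
    have := (Finset.mem_sdiff.mp hc).2
    simp only [Finset.mem_union] at this
    tauto
  have c5 := case4 hD s5 (fun c hc => hs c (hsub' c (h5s c hc)))
    (fun c hc => h4 c (hsub' c (h5s c hc))) hm t ht htn
    (fun c hc => hA2 c (hsub' c (h5s c hc))) (fun c hc => hA2' c (h5s c hc))
    (fun c hc => by
      have h1 := (h5n c hc).1
      rw [hs2, Finset.mem_filter] at h1
      have h2 := h5s c hc
      simp only [h2, true_and] at h1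
      push Not at h1
      exact h1)
    (fun c hc => by
      have h1 := (h5n c hc).2.2
      rw [hs4, Finset.mem_filter] at h1
      have h2 := h5s c hc
      simp only [h2, true_and] at h1
      push Not at h1
      exact h1)
    (fun c hc => by
      have h1 := (h5n c hc).2.1
      rw [hs3, Finset.mem_filter] at h1
      have h2 := h5s c hc
      simp only [h2, true_and] at h1
      push Not at h1
      exact h1)
  set U := t ^ 13 / m with hU
  have hU0 : 0 ≤ U := by positivity
  set V := t ^ 9 with hV
  have hV0 : 0 ≤ V := by positivity
  have hUH : U ≤ U * H := le_mul_of_one_le_right hU0 hH1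
  have hVH : V ≤ V * H := le_mul_of_one_le_right hV0 hH1
  have d8 : (D : ℝ) ^ 6 ≤ (D : ℝ) ^ 8 := pow_le_pow_right₀ hD1 (by norm_num)
  have c1' : (s1.card : ℝ) ≤ (D : ℝ) ^ 8 * (39 * (U * H) + 21 * (V * H)) := by
    refine c1.trans ?_
    have e1 : 7 * t ^ 6 * (t ^ 7 / m + 1) ≤ 7 * U + 7 * V := by
      have : t ^ 6 ≤ V := pow_le_pow_right₀ ht (by norm_num)
      have e2 : 7 * t ^ 6 * (t ^ 7 / m + 1) = 7 * U + 7 * t ^ 6 := by rw [hU]; ring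
      linarith
    have e3 : 6 * t ^ 13 / m * H = 6 * (U * H) := by rw [hU]; ring
    rw [e3]
    calc _ = (D : ℝ) ^ 8 * (3 * (6 * (U * H) + 7 * t ^ 6 * (t ^ 7 / m + 1))) := by ring
      _ ≤ _ := by gcongr; linarith
  have c2' : (s2.card : ℝ) ≤ (D : ℝ) ^ 8 * (3 * (U * H) + 12 * (V * H)) := by
    refine c2.trans ?_
    calc _ ≤ 3 * (D : ℝ) ^ 8 * (U * H + 4 * V) := by gcongr
      _ = (D : ℝ) ^ 8 * (3 * (U * H + 4 * V)) := by ring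
      _ ≤ _ := by gcongr; linarith
  have c3' : (s3.card : ℝ) ≤ (D : ℝ) ^ 8 * (U * H + 4 * (V * H)) := by
    refine c3.trans ?_
    calc _ ≤ (D : ℝ) ^ 8 * (U * H + 4 * V) := by gcongr
      _ ≤ _ := by gcongr
  have c4' : (s4.card : ℝ) ≤ (D : ℝ) ^ 8 * (3 * (U * H) + 36 * (V * H)) := by
    refine c4.trans ?_
    calc _ ≤ 3 * (D : ℝ) ^ 8 * (U * H + 12 * V) := by gcongr
      _ = (D : ℝ) ^ 8 * (3 * (U * H + 12 * V)) := by ring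
      _ ≤ _ := by gcongr; linarith
  have c5' : (s5.card : ℝ) ≤ (D : ℝ) ^ 8 * (7962624 * (U * H)) := by
    refine c5.trans ?_
    have : 7962624 * t ^ 12 / m ≤ 7962624 * (U * H) := by
      calc 7962624 * t ^ 12 / m ≤ 7962624 * t ^ 13 / m := by gcongr; norm_num
        _ = 7962624 * U := by rw [hU]; ring
        _ ≤ _ := by gcongr
    gcongr
  calc (s.card : ℝ) ≤ (D : ℝ) ^ 8 * (39 * (U * H) + 21 * (V * H)) +
        ((D : ℝ) ^ 8 * (3 * (U * H) + 12 * (V * H)) + (D : ℝ) ^ 8 * (U * H + 4 * (V * H)) +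
        (D : ℝ) ^ 8 * (3 * (U * H) + 36 * (V * H)) + (D : ℝ) ^ 8 * (7962624 * (U * H))) := by
        linarith
    _ = (D : ℝ) ^ 8 * (7962670 * (U * H) + 73 * (V * H)) := by ring
    _ ≤ (D : ℝ) ^ 8 * (10 ^ 7 * (U * H) + 10 ^ 7 * (V * H)) := by
        have : 0 ≤ U * H := by positivity
        have : 0 ≤ V * H := by positivity
        gcongr <;> norm_num
    _ = _ := by ring

end Main4

def solSet (k m n : ℕ) : Set (Fin k → ℕ) :=
  {a | (∀ i, 0 < a i) ∧ Monotone a ∧ (m : ℚ) / n = ∑ i, (1 : ℚ) / a i}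

lemma numSols_eq (k m n : ℕ) : numSols k m n = (solSet k m n).ncard := rfl

lemma solSet_succ {k m n : ℕ} (hm : 0 < m) (hn : 0 < n) {a : Fin (k + 1) → ℕ}
    (ha : a ∈ solSet (k + 1) m n) :
    n ≤ m * a 0 ∧ m * a 0 ≤ (k + 1) * n ∧ (0 < k → n < m * a 0) ∧
      Fin.tail a ∈ solSet k (m * a 0 - n) (n * a 0) := by
  obtain ⟨hp, hmono, heq⟩ := ha
  have p0 : (0 : ℚ) < a 0 := by exact_mod_cast hp 0
  have hn0 : (0 : ℚ) < n := by exact_mod_cast hn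
  rw [Fin.sum_univ_succ] at heq
  set S := ∑ i : Fin k, (1 : ℚ) / a i.succ with hS
  have hS0 : 0 ≤ S := Finset.sum_nonneg (fun i _ => by positivity)
  have hSpos : 0 < k → 0 < S := by
    intro hk
    have : Nonempty (Fin k) := ⟨⟨0, hk⟩⟩
    exact Finset.sum_pos (fun i _ => by have : (0 : ℚ) < a i.succ := by exact_mod_cast hp _
                                        positivity) Finset.univ_nonempty
  have hSle : S ≤ k * (1 / a 0) := by
    have : S ≤ ∑ i : Fin k, (1 : ℚ) / a 0 := by
      refine Finset.sum_le_sum (fun i _ => ?_)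
      have : (a 0 : ℚ) ≤ a i.succ := by exact_mod_cast hmono (Fin.zero_le _)
      gcongr
    simpa using this
  have e1 : (m : ℚ) * a 0 = n + n * a 0 * S := by
    field_simp at heq
    linarith
  have h1 : n ≤ m * a 0 := by
    have : (n : ℚ) ≤ m * a 0 := by rw [e1]; have : 0 ≤ n * a 0 * S := by positivity
                                   linarith
    exact_mod_cast this
  refine ⟨h1, ?_, ?_, fun i => hp _, fun i j hij => hmono (Fin.succ_le_succ_iff.mpr hij), ?_⟩
  · have : (m : ℚ) * a 0 ≤ (k + 1) * n := by
      rw [e1]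
      have : n * a 0 * S ≤ n * a 0 * (k * (1 / a 0)) := by gcongr
      have e2 : n * a 0 * (k * (1 / a 0)) = (k * n : ℚ) := by field_simp
      linarith
    exact_mod_cast this
  · intro hk
    have : (n : ℚ) < m * a 0 := by
      have := hSpos hk
      rw [e1]; have : 0 < n * a 0 * S := by positivity
      linarith
    exact_mod_cast this
  · rw [Nat.cast_sub h1]
    push_cast
    rw [e1]
    simp only [Fin.tail]
    rw [← hS]
    field_simp
    ring

lemma solSet_finite : ∀ (k m n : ℕ), 0 < n → (solSet k m n).Finite := by
  intro k
  induction k with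
  | zero => intro m n _; exact Set.toFinite _
  | succ k ih =>
    intro m n hn
    rcases Nat.eq_zero_or_pos m with hm | hm
    · subst hm
      have : solSet (k + 1) 0 n = ∅ := by
        ext a
        simp only [Set.mem_empty_iff_false, iff_false]
        rintro ⟨hp, _, h⟩
        have : 0 < ∑ i : Fin (k + 1), (1 : ℚ) / a i :=
          Finset.sum_pos (fun i _ => by have : (0 : ℚ) < a i := by exact_mod_cast hp _
                                        positivity) Finset.univ_nonempty
        simp at h
        simp only [one_div] at this
        linarith
      rw [this]; exact Set.finite_empty
    · have hsub : solSet (k + 1) m n ⊆ ⋃ b ∈ (Finset.Icc 1 ((k + 1) * n) : Finset ℕ),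
          (fun v : Fin k → ℕ => (Fin.cons b v : Fin (k + 1) → ℕ)) ''
            (solSet k (m * b - n) (n * b)) := by
        intro a ha
        obtain ⟨h1, h2, _, h3⟩ := solSet_succ hm hn ha
        simp only [Set.mem_iUnion]
        refine ⟨a 0, Finset.mem_Icc.mpr ⟨ha.1 0, ?_⟩, Fin.tail a, h3, Fin.cons_self_tail a⟩
        exact le_trans (Nat.le_mul_of_pos_left _ hm) h2
      refine Set.Finite.subset ?_ hsub
      refine Set.Finite.biUnion (Finset.finite_toSet _) (fun b hb => ?_)
      exact Set.Finite.image _ (ih _ _ (Nat.mul_pos hn (Finset.mem_Icc.mp hb).1))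

lemma numSols_zero_of_lt {k m n : ℕ} (hk : 0 < k) (hm : 0 < m) (hn : 0 < n) (h : k * n < m) :
    numSols k m n = 0 := by
  obtain ⟨k, rfl⟩ : ∃ j, k = j + 1 := ⟨k - 1, by omega⟩
  rw [numSols_eq, Set.ncard_eq_zero (solSet_finite _ _ _ hn)]
  ext a
  simp only [Set.mem_empty_iff_false, iff_false]
  intro ha
  obtain ⟨_, h2, _, _⟩ := solSet_succ hm hn ha
  have := Nat.le_mul_of_pos_right m (ha.1 0)
  omega

/-- The recursion for the number of solutions. -/
lemma numSols_succ_le {k m n : ℕ} (hk : 0 < k) (hm : 0 < m) (hn : 0 < n) :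
    numSols (k + 1) m n ≤ ∑ b ∈ (Finset.Icc 1 ((k + 1) * n)).filter
      (fun b => n < m * b ∧ m * b ≤ (k + 1) * n), numSols k (m * b - n) (n * b) := by
  classical
  set I := (Finset.Icc 1 ((k + 1) * n)).filter (fun b => n < m * b ∧ m * b ≤ (k + 1) * n) with hI
  have hfin : ∀ b ∈ I, (solSet k (m * b - n) (n * b)).Finite := fun b hb =>
    solSet_finite _ _ _ (Nat.mul_pos hn (Finset.mem_Icc.mp (Finset.mem_filter.mp hb).1).1)
  have h1 : (solSet_finite (k + 1) m n hn).toFinset.card ≤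
      ∑ b ∈ I, numSols k (m * b - n) (n * b) := by
    have hmaps : ∀ a ∈ (solSet_finite (k + 1) m n hn).toFinset, a 0 ∈ I := by
      intro a ha
      rw [Set.Finite.mem_toFinset] at ha
      obtain ⟨_, h2, h3, h4⟩ := solSet_succ hm hn ha
      rw [hI, Finset.mem_filter, Finset.mem_Icc]
      exact ⟨⟨ha.1 0, le_trans (Nat.le_mul_of_pos_left _ hm) h2⟩, h3 hk, h2⟩
    rw [Finset.card_eq_sum_card_fiberwise hmaps]
    refine Finset.sum_le_sum (fun b hb => ?_)
    rw [numSols_eq, Set.ncard_eq_toFinset_card _ (hfin b hb)]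
    apply Finset.card_le_card_of_injOn Fin.tail
    · intro a ha
      simp only [Finset.coe_filter, Set.Finite.mem_toFinset, Set.mem_ofPred_eq] at ha
      obtain ⟨_, h2, h3, h4⟩ := solSet_succ hm hn ha.1
      rw [ha.2] at h4
      simpa using h4
    · intro a ha b' hb' h
      simp only [Finset.coe_filter, Set.Finite.mem_toFinset, Set.mem_ofPred_eq] at ha hb'
      rw [← Fin.cons_self_tail a, ← Fin.cons_self_tail b', h, ha.2, hb'.2]
  rw [numSols_eq, Set.ncard_eq_toFinset_card _ (solSet_finite (k + 1) m n hn)]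
  exact h1

lemma solSet_four {m n : ℕ} (hm : 0 < m) (hn : 0 < n) {a : Fin 4 → ℕ} (ha : a ∈ solSet 4 m n) :
    ∃ (c : Conf) (C : ℕ), Valid m n (96 * n ^ 4) c ∧ c.A1 = a 0 ∧ c.A2 = a 1 ∧
      m * a 0 ≤ 4 * n ∧ a 1 * (m * a 0 - n) ≤ 3 * n * a 0 ∧
      a 2 = c.u0 * c.p * c.y * C ∧ a 3 = c.v0 * c.q * c.z * C ∧
      c.e * C = c.l * (c.f * c.s) * (c.g * c.d) * (c.u0 * c.p * c.y + c.v0 * c.q * c.z) := by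
  obtain ⟨hp, hmono, heq⟩ := ha
  refine exists_conf hm hn (hp 0) (hmono (by decide)) (hmono (by decide)) (hmono (by decide)) ?_
  rw [Fin.sum_univ_four] at heq
  have p0 : (0 : ℚ) < a 0 := by exact_mod_cast hp 0
  have p1 : (0 : ℚ) < a 1 := by exact_mod_cast hp 1
  have p2 : (0 : ℚ) < a 2 := by exact_mod_cast hp 2
  have p3 : (0 : ℚ) < a 3 := by exact_mod_cast hp 3
  have hn0 : (0 : ℚ) < n := by exact_mod_cast hn
  have : (n : ℚ) * (a 1 * a 2 * a 3 + a 0 * a 2 * a 3 + a 0 * a 1 * a 3 + a 0 * a 1 * a 2) =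
      m * (a 0 * a 1 * a 2 * a 3) := by
    field_simp at heq
    linarith
  exact_mod_cast this

lemma numSols_four {m n D : ℕ} (hm : 0 < m) (hn : 0 < n)
    (hD : ∀ K : ℕ, 0 < K → K ≤ (96 * n ^ 4) ^ 20 → K.divisors.card ≤ D)
    (t H : ℝ) (ht : 1 ≤ t) (htn : t ^ 8 = n) (hH1 : 1 ≤ H)
    (hH : ∑ i ∈ (Icc 1 (12 * n ^ 2) : Finset ℕ), (1 : ℝ) / i ≤ H) :
    (numSols 4 m n : ℝ) ≤ 10 ^ 7 * (D : ℝ) ^ 8 * H * (t ^ 13 / m + t ^ 9) := by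
  classical
  have : Nonempty Conf := ⟨⟨0, 0, 0, 0, 0, 0, 0, 0, 0, 0, 0, 0, 0⟩⟩
  choose! F C h1 h2 h3 h4 h5 h6 h7 h8 using fun (a : Fin 4 → ℕ) (ha : a ∈ solSet 4 m n) =>
    solSet_four hm hn ha
  have hfin := solSet_finite 4 m n hn
  have hinj : Set.InjOn F (solSet 4 m n) := by
    intro a ha b hb hab
    have hC : C a = C b := by
      have ea := h8 a ha
      have eb := h8 b hb
      rw [hab, ← eb] at ea
      exact Nat.eq_of_mul_eq_mul_left (h1 b hb).pe ea
    funext i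
    fin_cases i
    · change a 0 = b 0
      rw [← h2 a ha, ← h2 b hb, hab]
    · change a 1 = b 1
      rw [← h3 a ha, ← h3 b hb, hab]
    · change a 2 = b 2
      rw [h6 a ha, h6 b hb, hab, hC]
    · change a 3 = b 3
      rw [h7 a ha, h7 b hb, hab, hC]
  have hcard : numSols 4 m n = (hfin.toFinset.image F).card := by
    rw [Finset.card_image_of_injOn (by simpa using hinj), numSols_eq,
      Set.ncard_eq_toFinset_card _ hfin]
  rw [hcard]
  refine main4 hD _ ?_ ?_ ?_ hm (by positivity) t H ht htn hH1 hH
  · intro c hc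
    obtain ⟨a, ha, rfl⟩ := Finset.mem_image.mp hc
    exact h1 a (by simpa using ha)
  · intro c hc
    obtain ⟨a, ha, rfl⟩ := Finset.mem_image.mp hc
    have ha : a ∈ solSet 4 m n := by simpa using ha
    rw [h2 a ha]; exact h4 a ha
  · intro c hc
    obtain ⟨a, ha, rfl⟩ := Finset.mem_image.mp hc
    have ha : a ∈ solSet 4 m n := by simpa using ha
    rw [h2 a ha, h3 a ha]; exact h5 a ha

lemma sum_inv_le_log (N : ℕ) : ∑ i ∈ (Icc 1 N : Finset ℕ), (1 : ℝ) / i ≤ 1 + Real.log N := by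
  have h := harmonic_le_one_add_log N
  rw [harmonic_eq_sum_Icc] at h
  push_cast at h
  simpa only [one_div] using h

/-- The bound for four unit fractions. -/
lemma four_bound : ∃ C : ℝ, 0 < C ∧ ∀ m n : ℕ, 0 < m → 0 < n →
    (numSols 4 m n : ℝ) ≤ C * (n : ℝ) ^ (1 / 200 : ℝ) *
      ((n : ℝ) ^ (13 / 8 : ℝ) / m + (n : ℝ) ^ (9 / 8 : ℝ)) := by
  obtain ⟨C0, hC0, hdiv⟩ := divisor_bound (1 / 256000) (by norm_num)
  obtain ⟨w, hw⟩ : ∃ w : ℝ, w = 96 ^ 20 := ⟨_, rfl⟩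
  have hw0 : 0 < w := by rw [hw]; positivity
  obtain ⟨c, hc⟩ : ∃ c : ℝ, c = w ^ (1 / 256000 : ℝ) := ⟨_, rfl⟩
  have hc0 : 0 < c := by rw [hc]; positivity
  obtain ⟨w2, hw2⟩ : ∃ w2 : ℝ, w2 = 12 := ⟨_, rfl⟩
  have hw20 : 0 < w2 := by rw [hw2]; positivity
  obtain ⟨c2, hc2⟩ : ∃ c2 : ℝ, c2 = w2 ^ (1 / 800 : ℝ) := ⟨_, rfl⟩
  have hc20 : 0 < c2 := by rw [hc2]; positivity
  set h0 : ℝ := 1 + 800 * c2 with hh0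
  have hh0p : 0 < h0 := by positivity
  refine ⟨10 ^ 7 * (C0 * c) ^ 8 * h0, by positivity, ?_⟩
  intro m n hm hn
  have hn1 : (1 : ℝ) ≤ n := by exact_mod_cast hn
  have hn0 : (0 : ℝ) < n := by linarith
  set X : ℝ := C0 * (c * (n : ℝ) ^ (80 / 256000 : ℝ)) with hX
  have hX0 : 0 ≤ X := by positivity
  have e1 : (((96 * n ^ 4) ^ 20 : ℕ) : ℝ) ^ (1 / 256000 : ℝ) = c * (n : ℝ) ^ (80 / 256000 : ℝ) := by
    push_cast
    have : ((96 : ℝ) * n ^ 4) ^ 20 = w * (n : ℝ) ^ (80 : ℝ) := by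
      rw [mul_pow, ← pow_mul, ← Real.rpow_natCast (n : ℝ), hw]
      norm_num
    rw [this, Real.mul_rpow hw0.le (by positivity), ← Real.rpow_mul (by positivity), ← hc]
    congr 2
    norm_num
  have hD : ∀ K : ℕ, 0 < K → K ≤ (96 * n ^ 4) ^ 20 → K.divisors.card ≤ ⌊X⌋₊ := by
    intro K hK hKle
    apply Nat.le_floor
    refine (hdiv K hK).trans ?_
    rw [hX, ← e1]
    gcongr
  have ht : (1 : ℝ) ≤ (n : ℝ) ^ (1 / 8 : ℝ) := Real.one_le_rpow hn1 (by norm_num)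
  have tp : ∀ j : ℕ, ((n : ℝ) ^ (1 / 8 : ℝ)) ^ j = (n : ℝ) ^ ((j : ℝ) / 8) := by
    intro j
    rw [← Real.rpow_natCast, ← Real.rpow_mul (by positivity)]
    congr 1; ring
  have htn : ((n : ℝ) ^ (1 / 8 : ℝ)) ^ 8 = n := by rw [tp]; norm_num
  have hlog : 0 ≤ Real.log ((12 * n ^ 2 : ℕ) : ℝ) := Real.log_natCast_nonneg _
  have key := numSols_four hm hn hD ((n : ℝ) ^ (1 / 8 : ℝ)) (1 + Real.log ((12 * n ^ 2 : ℕ) : ℝ)) ht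
    htn (by linarith) (sum_inv_le_log _)
  rw [tp, tp] at key
  refine key.trans ?_
  have hfl : (⌊X⌋₊ : ℝ) ^ 8 ≤ (C0 * c) ^ 8 * (n : ℝ) ^ (1 / 400 : ℝ) := by
    calc (⌊X⌋₊ : ℝ) ^ 8 ≤ X ^ 8 := by gcongr; exact Nat.floor_le hX0
      _ = (C0 * c) ^ 8 * ((n : ℝ) ^ (80 / 256000 : ℝ)) ^ 8 := by rw [hX]; ring
      _ = _ := by
        rw [← Real.rpow_natCast ((n : ℝ) ^ (80 / 256000 : ℝ)), ← Real.rpow_mul (by positivity)]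
        norm_num
  have hH : 1 + Real.log ((12 * n ^ 2 : ℕ) : ℝ) ≤ h0 * (n : ℝ) ^ (1 / 400 : ℝ) := by
    have h1 := Real.log_le_rpow_div (x := ((12 * n ^ 2 : ℕ) : ℝ)) (by positivity)
      (show (0 : ℝ) < 1 / 800 by norm_num)
    have h2 : ((12 * n ^ 2 : ℕ) : ℝ) ^ (1 / 800 : ℝ) =
        c2 * (n : ℝ) ^ (1 / 400 : ℝ) := by
      push_cast
      rw [← hw2, Real.mul_rpow hw20.le (by positivity), ← Real.rpow_natCast (n : ℝ),
        ← Real.rpow_mul (by positivity), ← hc2]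
      congr 2
      norm_num
    rw [h2] at h1
    have h3 : (1 : ℝ) ≤ (n : ℝ) ^ (1 / 400 : ℝ) := Real.one_le_rpow hn1 (by norm_num)
    rw [hh0]
    calc _ ≤ 1 * (n : ℝ) ^ (1 / 400 : ℝ) +
          c2 * (n : ℝ) ^ (1 / 400 : ℝ) / (1 / 800) := by linarith
      _ = _ := by ring
  have e2 : (n : ℝ) ^ (1 / 200 : ℝ) = (n : ℝ) ^ (1 / 400 : ℝ) * (n : ℝ) ^ (1 / 400 : ℝ) := by
    rw [← Real.rpow_add hn0]; norm_num
  rw [e2]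
  push_cast at hH hlog ⊢
  calc _ ≤ 10 ^ 7 * ((C0 * c) ^ 8 * (n : ℝ) ^ (1 / 400 : ℝ)) * (h0 * (n : ℝ) ^ (1 / 400 : ℝ)) *
        ((n : ℝ) ^ (13 / 8 : ℝ) / m + (n : ℝ) ^ (9 / 8 : ℝ)) := by
        gcongr
    _ = _ := by ring

/-- The bound for five unit fractions. -/
lemma five_bound : ∃ C : ℝ, 0 < C ∧ ∀ m n : ℕ, 0 < m → 0 < n →
    (numSols 5 m n : ℝ) ≤ C * ((n : ℝ) ^ 2 / m) ^ (327 / 200 : ℝ) := by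
  obtain ⟨C4, hC4, h4⟩ := four_bound
  obtain ⟨w, hw⟩ : ∃ w : ℝ, w = 4 := ⟨_, rfl⟩
  have hw0 : 0 < w := by rw [hw]; positivity
  obtain ⟨c, hc⟩ : ∃ c : ℝ, c = w ^ (1 / 200 : ℝ) := ⟨_, rfl⟩
  have hc0 : 0 < c := by rw [hc]; positivity
  obtain ⟨w2, hw2⟩ : ∃ w2 : ℝ, w2 = 5 := ⟨_, rfl⟩
  have hw20 : 0 < w2 := by rw [hw2]; positivity
  obtain ⟨c2, hc2⟩ : ∃ c2 : ℝ, c2 = w2 ^ (327 / 200 : ℝ) := ⟨_, rfl⟩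
  have hc20 : 0 < c2 := by rw [hc2]; positivity
  set h0 : ℝ := 1 + 200 * c with hh0
  have hh0p : 0 < h0 := by positivity
  refine ⟨C4 * (h0 + 5) * c2, by positivity, ?_⟩
  intro m n hm hn
  have hn1 : (1 : ℝ) ≤ n := by exact_mod_cast hn
  have hn0 : (0 : ℝ) < n := by linarith
  have hm1 : (1 : ℝ) ≤ m := by exact_mod_cast hm
  have hm0 : (0 : ℝ) < m := by linarith
  rcases lt_or_ge (5 * n) m with h5 | h5
  · rw [numSols_zero_of_lt (by norm_num) hm hn h5]
    simp only [Nat.cast_zero]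
    positivity
  have h5r : (m : ℝ) ≤ 5 * n := by exact_mod_cast h5
  set B : ℝ := 5 * ((n : ℝ) ^ 2 / m) with hB
  have hBn : (n : ℝ) ≤ B := by
    rw [hB, mul_div_assoc', le_div_iff₀ hm0]
    nlinarith
  have hB1 : 1 ≤ B := by linarith
  have hB0 : 0 < B := by linarith
  have hrec := numSols_succ_le (k := 4) (by norm_num) hm hn
  set I := (Finset.Icc 1 ((4 + 1) * n)).filter (fun b => n < m * b ∧ m * b ≤ (4 + 1) * n) with hI
  have hterm : ∀ b ∈ I, (numSols 4 (m * b - n) (n * b) : ℝ) ≤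
      C4 * B ^ (1 / 200 : ℝ) * (B ^ (13 / 8 : ℝ) * (1 / (m * b - n : ℕ)) + B ^ (9 / 8 : ℝ)) := by
    intro b hb
    rw [hI, Finset.mem_filter, Finset.mem_Icc] at hb
    obtain ⟨⟨hb1, _⟩, hb2, hb3⟩ := hb
    have hpos : 0 < m * b - n := by omega
    have hposr : (0 : ℝ) < (m * b - n : ℕ) := by exact_mod_cast hpos
    refine (h4 (m * b - n) (n * b) hpos (Nat.mul_pos hn hb1)).trans ?_
    have hnb : ((n * b : ℕ) : ℝ) ≤ B := by
      rw [hB, mul_div_assoc', le_div_iff₀ hm0]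
      have : (m : ℝ) * b ≤ 5 * n := by exact_mod_cast hb3
      push_cast
      nlinarith
    rw [mul_one_div]
    gcongr
  have hcard : (I.card : ℝ) ≤ 5 * B ^ (1 / 2 : ℝ) := by
    have h1 : (I.card : ℝ) ≤ 5 * (n / m) := by
      have h2 : I.card ≤ (Finset.Icc 1 ⌊5 * ((n : ℝ) / m)⌋₊).card := by
        apply Finset.card_le_card
        intro b hb
        rw [hI, Finset.mem_filter, Finset.mem_Icc] at hb
        obtain ⟨⟨hb1, _⟩, hb2, hb3⟩ := hb
        rw [Finset.mem_Icc]
        refine ⟨hb1, Nat.le_floor ?_⟩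
        rw [mul_div_assoc', le_div_iff₀ hm0]
        have : (m : ℝ) * b ≤ 5 * n := by exact_mod_cast hb3
        linarith
      rw [Nat.card_Icc, Nat.add_sub_cancel] at h2
      exact le_trans (by exact_mod_cast h2) (Nat.floor_le (by positivity))
    refine h1.trans ?_
    have h3 : (n : ℝ) / m ≤ B ^ (1 / 2 : ℝ) := by
      rw [← Real.sqrt_eq_rpow]
      apply Real.le_sqrt_of_sq_le
      rw [hB, div_pow]
      calc (n : ℝ) ^ 2 / (m : ℝ) ^ 2 ≤ (n : ℝ) ^ 2 / m := by gcongr; nlinarith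
        _ ≤ _ := by have : 0 ≤ (n : ℝ) ^ 2 / m := by positivity
                    linarith
    linarith
  have hsum : ∑ b ∈ I, (1 : ℝ) / (m * b - n : ℕ) ≤ h0 * B ^ (1 / 200 : ℝ) := by
    have h1 := sum_inv_inj I (fun a => m * a - n) (4 * n) (by
      intro a ha b hb hab
      rw [hI, Finset.mem_coe, Finset.mem_filter] at ha hb
      exact inj_sub hm ha.2.1 hb.2.1 (by simp only at hab; rw [hab])) (by
      intro a ha
      rw [hI, Finset.mem_filter] at ha
      obtain ⟨_, h1, h2⟩ := ha
      constructor <;> omega)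
    refine h1.trans ((sum_inv_le_log _).trans ?_)
    have h2 := Real.log_le_rpow_div (x := ((4 * n : ℕ) : ℝ)) (by positivity)
      (show (0 : ℝ) < 1 / 200 by norm_num)
    have h3 : ((4 * n : ℕ) : ℝ) ^ (1 / 200 : ℝ) ≤ c * B ^ (1 / 200 : ℝ) := by
      rw [hc, ← Real.mul_rpow (by positivity) (by positivity), hw]
      push_cast
      gcongr
    have h4 : (1 : ℝ) ≤ B ^ (1 / 200 : ℝ) := Real.one_le_rpow hB1 (by norm_num)
    rw [hh0]
    have h5 : ((4 * n : ℕ) : ℝ) ^ (1 / 200 : ℝ) / (1 / 200) =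
      200 * ((4 * n : ℕ) : ℝ) ^ (1 / 200 : ℝ) := by ring
    rw [h5] at h2
    calc _ ≤ B ^ (1 / 200 : ℝ) + 200 * (c * B ^ (1 / 200 : ℝ)) := by linarith
      _ = _ := by ring
  have e1 : B ^ (1 / 200 : ℝ) * B ^ (13 / 8 : ℝ) * B ^ (1 / 200 : ℝ) = B ^ (327 / 200 : ℝ) := by
    rw [← Real.rpow_add hB0, ← Real.rpow_add hB0]; norm_num
  have e2 : B ^ (1 / 200 : ℝ) * B ^ (9 / 8 : ℝ) * B ^ (1 / 2 : ℝ) ≤ B ^ (327 / 200 : ℝ) := by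
    rw [← Real.rpow_add hB0, ← Real.rpow_add hB0]
    apply Real.rpow_le_rpow_of_exponent_le hB1; norm_num
  have e3 : B ^ (327 / 200 : ℝ) = c2 * ((n : ℝ) ^ 2 / m) ^ (327 / 200 : ℝ) := by
    rw [hB, hc2, hw2, Real.mul_rpow (by norm_num) (by positivity)]
  calc (numSols 5 m n : ℝ) ≤ ∑ b ∈ I, (numSols 4 (m * b - n) (n * b) : ℝ) := by
        exact_mod_cast hrec
    _ ≤ ∑ b ∈ I, C4 * B ^ (1 / 200 : ℝ) *
        (B ^ (13 / 8 : ℝ) * (1 / (m * b - n : ℕ)) + B ^ (9 / 8 : ℝ)) := Finset.sum_le_sum hterm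
    _ = C4 * B ^ (1 / 200 : ℝ) * (B ^ (13 / 8 : ℝ) * ∑ b ∈ I, (1 : ℝ) / (m * b - n : ℕ) +
        I.card * B ^ (9 / 8 : ℝ)) := by
        rw [← Finset.mul_sum, Finset.sum_add_distrib, ← Finset.mul_sum, Finset.sum_const,
          nsmul_eq_mul]
    _ ≤ C4 * B ^ (1 / 200 : ℝ) * (B ^ (13 / 8 : ℝ) * (h0 * B ^ (1 / 200 : ℝ)) +
        5 * B ^ (1 / 2 : ℝ) * B ^ (9 / 8 : ℝ)) := by gcongr
    _ = C4 * (h0 * (B ^ (1 / 200 : ℝ) * B ^ (13 / 8 : ℝ) * B ^ (1 / 200 : ℝ)) +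
        5 * (B ^ (1 / 200 : ℝ) * B ^ (9 / 8 : ℝ) * B ^ (1 / 2 : ℝ))) := by ring
    _ ≤ C4 * (h0 * B ^ (327 / 200 : ℝ) + 5 * B ^ (327 / 200 : ℝ)) := by
        rw [e1]; gcongr
    _ = _ := by rw [e3]; ring

/-- One step of the induction on the number of unit fractions. -/
lemma step_bound {A Z E C : ℝ} {k : ℕ} (hC : 0 < C)
    (hZ : ∀ J : Finset ℕ, ∑ i ∈ J, 1 / (i : ℝ) ^ (3 / 2 : ℝ) ≤ Z) (hE : 3 / 2 ≤ E)
    (hA : 100 ≤ A) (hAZ : 2 * Z ≤ A) (hk : 5 ≤ k) (hpow : 2 * ((k : ℝ) + 1) ≤ 50 ^ E)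
    (ih : ∀ m n : ℕ, 0 < m → 0 < n →
      (numSols k m n : ℝ) ≤ C * (A * k * (n : ℝ) ^ 2 / m) ^ E) (m n : ℕ) (hm : 0 < m) (hn : 0 < n) :
    (numSols (k + 1) m n : ℝ) ≤ C * (A * ((k : ℝ) + 1) * (n : ℝ) ^ 2 / m) ^ (2 * E) := by
  have hn1 : (1 : ℝ) ≤ n := by exact_mod_cast hn
  have hn0 : (0 : ℝ) < n := by linarith
  have hm1 : (1 : ℝ) ≤ m := by exact_mod_cast hm
  have hm0 : (0 : ℝ) < m := by linarith
  have hk0 : (0 : ℝ) < k := by exact_mod_cast (by omega : 0 < k)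
  have hA0 : 0 < A := by linarith
  have hE0 : 0 < E := by linarith
  have hrec := numSols_succ_le (k := k) (by omega) hm hn
  set I := (Finset.Icc 1 ((k + 1) * n)).filter (fun b => n < m * b ∧ m * b ≤ (k + 1) * n) with hI
  set P : ℝ := (4 * A * k * n ^ 4 / m ^ 2) ^ E with hP
  set R : ℝ := (2 * A * k * (k + 1) * n ^ 3 / m ^ 2) ^ E with hR
  set B : ℝ := A ^ 2 * (k + 1) ^ 2 * n ^ 4 / m ^ 2 with hB
  have hP0 : 0 ≤ P := by positivity
  have hR0 : 0 ≤ R := by positivity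
  have hB0 : 0 ≤ B := by positivity
  have hG : (A * ((k : ℝ) + 1) * (n : ℝ) ^ 2 / m) ^ (2 * E) = B ^ E := by
    rw [Real.rpow_mul (by positivity)]
    congr 1
    rw [hB, show (2 : ℝ) = ((2 : ℕ) : ℝ) by norm_num, Real.rpow_natCast]
    field_simp
  rw [hG]
  have hterm : ∀ b ∈ I, (numSols k (m * b - n) (n * b) : ℝ) ≤
      C * (P * (1 / ((m * b - n : ℕ) : ℝ) ^ (3 / 2 : ℝ)) + R) := by
    intro b hb
    rw [hI, Finset.mem_filter, Finset.mem_Icc] at hb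
    obtain ⟨⟨hb1, _⟩, hb2, hb3⟩ := hb
    have hpos : 0 < m * b - n := by omega
    have hposr : (1 : ℝ) ≤ (m * b - n : ℕ) := by exact_mod_cast hpos
    have hpos0 : (0 : ℝ) < (m * b - n : ℕ) := by linarith
    refine (ih (m * b - n) (n * b) hpos (Nat.mul_pos hn hb1)).trans ?_
    have hb0 : (0 : ℝ) < b := by exact_mod_cast hb1
    have hb3' : (m : ℝ) * b ≤ (k + 1) * n := by exact_mod_cast hb3
    gcongr
    push_cast
    rcases le_or_gt (m * b) (2 * n) with h2 | h2
    · have h2' : (m : ℝ) * b ≤ 2 * n := by exact_mod_cast h2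
      have : (A * k * ((n : ℝ) * b) ^ 2 / (m * b - n : ℕ)) ^ E ≤
          P * (1 / ((m * b - n : ℕ) : ℝ) ^ (3 / 2 : ℝ)) := by
        rw [Real.div_rpow (by positivity) (by positivity), mul_one_div]
        have h3 : A * k * ((n : ℝ) * b) ^ 2 ≤ 4 * A * k * n ^ 4 / m ^ 2 := by
          rw [le_div_iff₀ (by positivity)]
          calc A * k * ((n : ℝ) * b) ^ 2 * m ^ 2 = A * k * n ^ 2 * (m * b) ^ 2 := by ring
            _ ≤ A * k * n ^ 2 * (2 * n) ^ 2 := by gcongr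
            _ = _ := by ring
        have h4 : ((m * b - n : ℕ) : ℝ) ^ (3 / 2 : ℝ) ≤ ((m * b - n : ℕ) : ℝ) ^ E :=
          Real.rpow_le_rpow_of_exponent_le hposr hE
        have h5 : (A * k * ((n : ℝ) * b) ^ 2) ^ E ≤ P := by
          rw [hP]; gcongr
        gcongr
      linarith
    · have h2' : 2 * (n : ℝ) < m * b := by exact_mod_cast h2
      have hsub : ((m * b - n : ℕ) : ℝ) = m * b - n := by
        rw [Nat.cast_sub hb2.le]; push_cast; ring
      have : (A * k * ((n : ℝ) * b) ^ 2 / (m * b - n : ℕ)) ^ E ≤ R := by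
        rw [hR]
        have h3 : A * k * ((n : ℝ) * b) ^ 2 / (m * b - n : ℕ) ≤
            2 * A * k * (k + 1) * n ^ 3 / m ^ 2 := by
          calc A * k * ((n : ℝ) * b) ^ 2 / (m * b - n : ℕ) ≤
                A * k * ((n : ℝ) * b) ^ 2 / (m * b / 2) := by
                gcongr
                rw [hsub]; linarith
            _ = 2 * A * k * n ^ 2 * (m * b) / m ^ 2 := by field_simp
            _ ≤ 2 * A * k * n ^ 2 * ((k + 1) * n) / m ^ 2 := by gcongr
            _ = _ := by ring
        gcongr
      have h6 : 0 ≤ P * (1 / ((m * b - n : ℕ) : ℝ) ^ (3 / 2 : ℝ)) := by positivity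
      linarith
  have hcard : (I.card : ℝ) ≤ (k + 1) * n := by
    have h2 : I.card ≤ (k + 1) * n := by
      refine (Finset.card_filter_le _ _).trans ?_
      simp
    exact_mod_cast h2
  have hsum : ∑ b ∈ I, 1 / ((m * b - n : ℕ) : ℝ) ^ (3 / 2 : ℝ) ≤ Z := by
    have hinj : Set.InjOn (fun b => m * b - n) (I : Set ℕ) := by
      intro a ha b hb hab
      rw [hI, Finset.mem_coe, Finset.mem_filter] at ha hb
      exact inj_sub hm ha.2.1 hb.2.1 (by simp only at hab; rw [hab])
    have := hZ (I.image (fun b => m * b - n))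
    rwa [Finset.sum_image hinj] at this
  have hZ0 : 0 ≤ Z := by simpa using hZ ∅
  have hPZ : P * Z ≤ B ^ E / 2 := by
    have h1 : P ≤ B ^ E * (1 / A) := by
      have h2 : 4 * A * k * n ^ 4 / m ^ 2 ≤ B * (1 / A) := by
        rw [hB]
        have : B * (1 / A) = A * (k + 1) ^ 2 * n ^ 4 / m ^ 2 := by rw [hB]; field_simp
        rw [← hB, this]
        have : 4 * A * k ≤ A * (k + 1) ^ 2 := by nlinarith [sq_nonneg ((k : ℝ) - 1)]
        gcongr
      calc P ≤ (B * (1 / A)) ^ E := by rw [hP]; gcongr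
        _ = B ^ E * (1 / A) ^ E := Real.mul_rpow hB0 (by positivity)
        _ ≤ B ^ E * (1 / A) ^ (1 : ℝ) := by
            gcongr ?_ * ?_
            apply Real.rpow_le_rpow_of_exponent_ge (by positivity)
            · rw [div_le_one hA0]; linarith
            · linarith
        _ = _ := by rw [Real.rpow_one]
    calc P * Z ≤ B ^ E * (1 / A) * (A / 2) := by gcongr; linarith
      _ = _ := by field_simp
  have hRI : (k + 1) * n * R ≤ B ^ E / 2 := by
    have h1 : n * R ≤ B ^ E * (1 / 50 ^ E) := by
      have h2 : (n : ℝ) ≤ (n : ℝ) ^ E := by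
        calc (n : ℝ) = (n : ℝ) ^ (1 : ℝ) := (Real.rpow_one _).symm
          _ ≤ _ := Real.rpow_le_rpow_of_exponent_le hn1 (by linarith)
      calc n * R ≤ (n : ℝ) ^ E * R := by gcongr
        _ = (n * (2 * A * k * (k + 1) * n ^ 3 / m ^ 2)) ^ E := by
            rw [hR, Real.mul_rpow hn0.le (by positivity)]
        _ ≤ (B / 50) ^ E := by
            have h3 : n * (2 * A * k * (k + 1) * n ^ 3 / m ^ 2) ≤ B / 50 := by
              have e1 : n * (2 * A * k * (k + 1) * n ^ 3 / m ^ 2) =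
                (2 * A * k * (k + 1)) * n ^ 4 / m ^ 2 := by ring
              have e2 : B / 50 = (A ^ 2 * (k + 1) ^ 2 / 50) * n ^ 4 / m ^ 2 := by rw [hB]; ring
              rw [e1, e2]
              have : 2 * A * k * (k + 1) ≤ A ^ 2 * (k + 1) ^ 2 / 50 := by
                have h7 : (2 * A * (k + 1)) * k ≤ (2 * A * (k + 1)) * (A * (k + 1) / 100) := by
                  gcongr
                  nlinarith
                calc _ = (2 * A * (k + 1)) * (k : ℝ) := by ring
                  _ ≤ _ := h7
                  _ = _ := by ring
              gcongr
            gcongr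
        _ = _ := by rw [Real.div_rpow hB0 (by norm_num), mul_one_div]
    have h50 : (0 : ℝ) < 50 ^ E := by positivity
    calc (k + 1) * n * R = (k + 1) * (n * R) := by ring
      _ ≤ (50 ^ E / 2) * (B ^ E * (1 / 50 ^ E)) := by gcongr; linarith
      _ = _ := by field_simp
  calc (numSols (k + 1) m n : ℝ) ≤ ∑ b ∈ I, (numSols k (m * b - n) (n * b) : ℝ) := by
        exact_mod_cast hrec
    _ ≤ ∑ b ∈ I, C * (P * (1 / ((m * b - n : ℕ) : ℝ) ^ (3 / 2 : ℝ)) + R) :=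
        Finset.sum_le_sum hterm
    _ = C * (P * ∑ b ∈ I, 1 / ((m * b - n : ℕ) : ℝ) ^ (3 / 2 : ℝ) + I.card * R) := by
        rw [← Finset.mul_sum, Finset.sum_add_distrib, ← Finset.mul_sum, Finset.sum_const,
          nsmul_eq_mul]
    _ ≤ C * (P * Z + (k + 1) * n * R) := by gcongr
    _ ≤ C * (B ^ E / 2 + B ^ E / 2) := by gcongr
    _ = _ := by ring

lemma pow_fifty (j : ℕ) : 2 * (((5 + j : ℕ) : ℝ) + 1) ≤ 50 ^ ((327 / 200 : ℝ) * 2 ^ j) := by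
  have h1 : 1 + ((j + 1 : ℕ) : ℝ) * 49 ≤ (1 + 49) ^ (j + 1) :=
    one_add_mul_le_pow (by norm_num) _
  have h2 : (50 : ℝ) ^ (j + 1) ≤ 50 ^ ((327 / 200 : ℝ) * 2 ^ j) := by
    rw [← Real.rpow_natCast]
    apply Real.rpow_le_rpow_of_exponent_le (by norm_num)
    have h3 : j + 1 ≤ 2 ^ j := Nat.lt_two_pow_self
    have h4 : ((j + 1 : ℕ) : ℝ) ≤ 2 ^ j := by exact_mod_cast h3
    have h5 : (0 : ℝ) < 2 ^ j := by positivity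
    linarith
  have h6 : (1 + 49 : ℝ) = 50 := by norm_num
  rw [h6] at h1
  push_cast at h1 ⊢
  have : (0 : ℝ) ≤ j := by positivity
  linarith

lemma general_bound : ∃ A C : ℝ, 100 ≤ A ∧ 0 < C ∧ ∀ j m n : ℕ, 0 < m → 0 < n →
    (numSols (5 + j) m n : ℝ) ≤
      C * (A * ((5 + j : ℕ) : ℝ) * (n : ℝ) ^ 2 / m) ^ ((327 / 200 : ℝ) * 2 ^ j) := by
  obtain ⟨C, hC, h5⟩ := five_bound
  have hsm : Summable (fun i : ℕ => 1 / (i : ℝ) ^ (3 / 2 : ℝ)) :=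
    Real.summable_one_div_nat_rpow.mpr (by norm_num)
  set Z : ℝ := ∑' i : ℕ, 1 / (i : ℝ) ^ (3 / 2 : ℝ) with hZd
  have hZ : ∀ J : Finset ℕ, ∑ i ∈ J, 1 / (i : ℝ) ^ (3 / 2 : ℝ) ≤ Z := fun J =>
    hsm.sum_le_tsum J (fun i _ => by positivity)
  have hA1 : 100 ≤ max 100 (2 * Z) := le_max_left _ _
  have hA2 : 2 * Z ≤ max 100 (2 * Z) := le_max_right _ _
  generalize max 100 (2 * Z) = A at hA1 hA2
  refine ⟨A, C, hA1, hC, ?_⟩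
  intro j
  induction j with
  | zero =>
    intro m n hm hn
    refine (h5 m n hm hn).trans ?_
    have hm0 : (0 : ℝ) < m := by exact_mod_cast hm
    simp only [pow_zero, mul_one, add_zero]
    have : (n : ℝ) ^ 2 / m ≤ A * ((5 : ℕ) : ℝ) * (n : ℝ) ^ 2 / m := by
      have h1 : 1 ≤ A * ((5 : ℕ) : ℝ) := by push_cast; linarith
      gcongr
      exact le_mul_of_one_le_left (by positivity) h1
    gcongr
  | succ j ih =>
    intro m n hm hn
    have hE : 3 / 2 ≤ (327 / 200 : ℝ) * 2 ^ j := by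
      have : (1 : ℝ) ≤ 2 ^ j := one_le_pow₀ (by norm_num)
      linarith
    have := step_bound hC hZ hE hA1 hA2 (by omega : 5 ≤ 5 + j) (pow_fifty j) ih m n hm hn
    rw [show (327 / 200 : ℝ) * 2 ^ (j + 1) = 2 * ((327 / 200 : ℝ) * 2 ^ j) by ring]
    rw [show 5 + (j + 1) = 5 + j + 1 by ring]
    push_cast at this ⊢
    exact this

theorem stmt_3 : ∀ ε : ℝ, 0 < ε → ∃ C : ℝ, 0 < C ∧
    ∀ k m n : ℕ, 5 ≤ k → 0 < m → 0 < n →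
      (numSols k m n : ℝ) ≤ C * ((k * n : ℕ) : ℝ) ^ ε *
        ((k : ℝ) ^ ((4 : ℝ) / 3) * (n : ℝ) ^ 2 / (m : ℝ)) ^ ((28 / 17 : ℝ) * 2 ^ (k - 5)) := by
  intro ε hε
  obtain ⟨A, C, hA, hC, hb⟩ := general_bound
  have hA0 : 0 < A := by linarith
  set N : ℕ := ⌈A ^ 3⌉₊ with hN
  set M : ℝ := A ^ ((327 / 200 : ℝ) * 2 ^ N) with hM
  have hM1 : 1 ≤ M := Real.one_le_rpow (by linarith) (by positivity)
  refine ⟨C * M, by positivity, ?_⟩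
  intro k m n hk hm hn
  obtain ⟨j, rfl⟩ : ∃ j, k = 5 + j := ⟨k - 5, by omega⟩
  have hj : 5 + j - 5 = j := by omega
  rw [hj]
  have hn1 : (1 : ℝ) ≤ n := by exact_mod_cast hn
  have hn0 : (0 : ℝ) < n := by linarith
  have hm0 : (0 : ℝ) < m := by exact_mod_cast hm
  rcases lt_or_ge ((5 + j) * n) m with h5 | h5
  · rw [numSols_zero_of_lt (by omega) hm hn h5, Nat.cast_zero]
    positivity
  refine (hb j m n hm hn).trans ?_
  set K : ℝ := ((5 + j : ℕ) : ℝ) with hK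
  have hK1 : 1 ≤ K := by rw [hK]; exact_mod_cast (by omega : 1 ≤ 5 + j)
  have hK0 : 0 < K := by linarith
  have h5r : (m : ℝ) ≤ K * n := by rw [hK]; exact_mod_cast h5
  have hKp : K ≤ K ^ (4 / 3 : ℝ) := by
    calc K = K ^ (1 : ℝ) := (Real.rpow_one K).symm
      _ ≤ _ := Real.rpow_le_rpow_of_exponent_le hK1 (by norm_num)
  set X : ℝ := K ^ (4 / 3 : ℝ) * (n : ℝ) ^ 2 / m with hX
  have hX1 : 1 ≤ X := by
    rw [hX, le_div_iff₀ hm0, one_mul]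
    calc (m : ℝ) ≤ K * n := h5r
      _ ≤ K ^ (4 / 3 : ℝ) * (n : ℝ) ^ 2 := by gcongr; nlinarith
  have hX0 : 0 < X := by linarith
  set E : ℝ := (327 / 200 : ℝ) * 2 ^ j with hE
  have hE0 : 0 < E := by positivity
  have hEle : E ≤ (28 / 17 : ℝ) * 2 ^ j := by
    rw [hE]; exact mul_le_mul_of_nonneg_right (by norm_num) (by positivity)
  have hXE : X ^ E ≤ X ^ ((28 / 17 : ℝ) * 2 ^ j) := Real.rpow_le_rpow_of_exponent_le hX1 hEle
  have hkn : (1 : ℝ) ≤ (((5 + j) * n : ℕ) : ℝ) ^ ε := by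
    apply Real.one_le_rpow _ hε.le
    exact_mod_cast Nat.mul_pos (by omega : 0 < 5 + j) hn
  have main : (A * K * (n : ℝ) ^ 2 / m) ^ E ≤ M * X ^ E := by
    rcases le_or_gt (5 + j) N with hjN | hjN
    · have h1 : A * K * (n : ℝ) ^ 2 / m ≤ A * X := by
        rw [hX]
        calc A * K * (n : ℝ) ^ 2 / m ≤ A * K ^ (4 / 3 : ℝ) * (n : ℝ) ^ 2 / m := by gcongr
          _ = _ := by ring
      calc (A * K * (n : ℝ) ^ 2 / m) ^ E ≤ (A * X) ^ E := by gcongr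
        _ = A ^ E * X ^ E := Real.mul_rpow hA0.le hX0.le
        _ ≤ M * X ^ E := by
          gcongr
          rw [hM]
          apply Real.rpow_le_rpow_of_exponent_le (by linarith)
          rw [hE]
          gcongr
          · norm_num
          · omega
    · have h1 : A ≤ K ^ (1 / 3 : ℝ) := by
        have h2 : A ^ 3 ≤ K := by
          refine (Nat.le_ceil _).trans ?_
          rw [hK]; exact_mod_cast hjN.le
        calc A = (A ^ 3) ^ (1 / 3 : ℝ) := by
              rw [← Real.rpow_natCast, ← Real.rpow_mul hA0.le]; norm_num
          _ ≤ _ := by gcongr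
      have h3 : A * K * (n : ℝ) ^ 2 / m ≤ X := by
        rw [hX]
        have : A * K ≤ K ^ (4 / 3 : ℝ) := by
          calc A * K ≤ K ^ (1 / 3 : ℝ) * K := by gcongr
            _ = K ^ (1 / 3 : ℝ) * K ^ (1 : ℝ) := by rw [Real.rpow_one]
            _ = _ := by rw [← Real.rpow_add hK0]; norm_num
        gcongr
      calc (A * K * (n : ℝ) ^ 2 / m) ^ E ≤ X ^ E := by gcongr
        _ ≤ M * X ^ E := le_mul_of_one_le_left (by positivity) hM1
  calc C * (A * K * (n : ℝ) ^ 2 / m) ^ E ≤ C * (M * X ^ ((28 / 17 : ℝ) * 2 ^ j)) := by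
        gcongr
        refine main.trans ?_
        gcongr
    _ = C * M * 1 * X ^ ((28 / 17 : ℝ) * 2 ^ j) := by ring
    _ ≤ _ := by gcongr
end

section
/- For every ε > 0 there exists a constant C = C(ε) > 0 such that for every integer k ≥ 1, the number f_k(1,1) of representations of 1 as a sum of k unit fractions satisfies f_k(1,1) ≤ C · k^( (7/51) · 2^(k-1) + ε ). -/
lemma gap_exists (t : ℕ) : ∀ x : ℚ, 0 < x → ∃ D : ℕ, 0 < D ∧ ∀ (s : Finset ℕ) (b : ℕ → ℕ),
    s.card ≤ t → (∀ j, 0 < b j) → ∑ j ∈ s, (1 : ℚ) / b j < x →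
    (1 : ℚ) / D ≤ x - ∑ j ∈ s, (1 : ℚ) / b j := by
  induction t with
  | zero =>
    intro x hx
    obtain ⟨n, hn⟩ := exists_nat_one_div_lt hx
    refine ⟨n + 1, Nat.succ_pos _, ?_⟩
    intro s b hs _ _
    have : s = ∅ := by simpa using hs
    subst this
    simp only [Finset.sum_empty, sub_zero]
    push_cast
    exact hn.le
  | succ t ih =>
    intro x hx
    obtain ⟨n, hn⟩ := exists_nat_one_div_lt (show (0 : ℚ) < x / (2 * (t + 1)) by positivity)
    have key : ∀ c : ℕ, ∃ D : ℕ, 0 < D ∧ ((1 : ℚ) / c < x → ∀ (s : Finset ℕ) (b : ℕ → ℕ),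
        s.card ≤ t → (∀ j, 0 < b j) → ∑ j ∈ s, (1 : ℚ) / b j < x - 1 / c →
        (1 : ℚ) / D ≤ x - 1 / c - ∑ j ∈ s, (1 : ℚ) / b j) := by
      intro c
      by_cases hc : (1 : ℚ) / c < x
      · obtain ⟨D, hD, h⟩ := ih (x - 1 / c) (by linarith)
        exact ⟨D, hD, fun _ => h⟩
      · exact ⟨1, one_pos, fun h => absurd h hc⟩
    choose F hF0 hF using key
    obtain ⟨m, hm⟩ := exists_nat_one_div_lt (show (0 : ℚ) < x / 2 by positivity)
    refine ⟨(m + 1) + ∑ c ∈ Finset.range (n + 1), F c, by positivity, ?_⟩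
    intro s b hs hb hlt
    by_cases hall : ∀ j ∈ s, n + 1 ≤ b j
    · have h1 : ∑ j ∈ s, (1 : ℚ) / b j ≤ s.card • (x / (2 * (t + 1))) := by
        apply Finset.sum_le_card_nsmul
        intro j hj
        refine le_trans ?_ hn.le
        apply one_div_le_one_div_of_le (by positivity)
        exact_mod_cast hall j hj
      have h2 : s.card • (x / (2 * ((t : ℚ) + 1))) ≤ x / 2 := by
        rw [nsmul_eq_mul]
        have : (s.card : ℚ) ≤ t + 1 := by exact_mod_cast hs
        calc (s.card : ℚ) * (x / (2 * ((t : ℚ) + 1))) ≤ (t + 1) * (x / (2 * ((t : ℚ) + 1))) := by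
              gcongr
          _ = x / 2 := by field_simp
      have h3 : (1 : ℚ) / ((m + 1 + ∑ c ∈ Finset.range (n + 1), F c : ℕ) : ℚ) ≤ 1 / ((m : ℚ) + 1) := by
        apply one_div_le_one_div_of_le (by positivity)
        exact_mod_cast Nat.le_add_right _ _
      linarith
    · push Not at hall
      obtain ⟨j, hj, hjn⟩ := hall
      have hsum := Finset.add_sum_erase s (fun j => (1 : ℚ) / b j) hj
      have hnn : 0 ≤ ∑ j ∈ s.erase j, (1 : ℚ) / b j := Finset.sum_nonneg (fun _ _ => by positivity)
      have h4 := hF (b j) (by linarith) (s.erase j) b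
        (by rw [Finset.card_erase_of_mem hj]; omega) hb (by linarith)
      have h5 : F (b j) ≤ ∑ c ∈ Finset.range (n + 1), F c :=
        Finset.single_le_sum (f := F) (fun _ _ => Nat.zero_le _) (Finset.mem_range.2 hjn)
      have h3 : (1 : ℚ) / ((m + 1 + ∑ c ∈ Finset.range (n + 1), F c : ℕ) : ℚ) ≤ 1 / (F (b j) : ℚ) := by
        apply one_div_le_one_div_of_le (by exact_mod_cast hF0 _)
        exact_mod_cast h5.trans (Nat.le_add_left _ _)
      linarith

/-- A positive number `1 - ∑ 1/b j` is at least `1 / ∏ b j`. -/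
lemma one_div_prod_le (b : ℕ → ℕ) (hb : ∀ j, 0 < b j) (i : ℕ)
    (h : ∑ j ∈ Finset.range i, (1 : ℚ) / b j < 1) :
    (1 : ℚ) / (∏ j ∈ Finset.range i, b j : ℕ) ≤ 1 - ∑ j ∈ Finset.range i, (1 : ℚ) / b j := by
  have hz : ∃ z : ℤ, ((∏ j ∈ Finset.range i, b j : ℕ) : ℚ) *
      (1 - ∑ j ∈ Finset.range i, (1 : ℚ) / b j) = z := by
    clear h
    induction i with
    | zero => exact ⟨1, by simp⟩
    | succ i ih =>
      obtain ⟨z, hz⟩ := ih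
      refine ⟨z * b i - (∏ j ∈ Finset.range i, b j : ℕ), ?_⟩
      have : (b i : ℚ) ≠ 0 := by exact_mod_cast (hb i).ne'
      rw [Finset.prod_range_succ, Finset.sum_range_succ]
      push_cast at hz ⊢
      rw [← hz]
      field_simp
      ring
  obtain ⟨z, hz⟩ := hz
  have hP : (0 : ℚ) < (∏ j ∈ Finset.range i, b j : ℕ) := by
    exact_mod_cast Finset.prod_pos (fun j _ => hb j)
  have hzpos : (0 : ℚ) < z := by
    rw [← hz]; exact mul_pos hP (by linarith)
  have hz1 : (1 : ℚ) ≤ z := by exact_mod_cast (show (0 : ℤ) < z by exact_mod_cast hzpos)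
  rw [div_le_iff₀ hP]
  linarith

lemma term_le (k : ℕ) (b : ℕ → ℕ) (hb : ∀ j, 0 < b j)
    (hmono : ∀ i j, i ≤ j → j < k → b i ≤ b j)
    (hsum : ∑ j ∈ Finset.range k, (1 : ℚ) / b j = 1) (i : ℕ) (hi : i < k) :
    ∑ j ∈ Finset.range i, (1 : ℚ) / b j < 1 ∧
    ∀ D : ℕ, 0 < D → (1 : ℚ) / D ≤ 1 - ∑ j ∈ Finset.range i, (1 : ℚ) / b j → b i ≤ k * D := by
  have hsplit := Finset.sum_range_add_sum_Ico (fun j => (1 : ℚ) / b j) hi.le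
  rw [hsum] at hsplit
  have hpos : 0 < ∑ j ∈ Finset.Ico i k, (1 : ℚ) / b j := by
    apply Finset.sum_pos
    · intro j _
      have := hb j
      positivity
    · exact ⟨i, by simp [hi]⟩
  have hbi : (0 : ℚ) < b i := by exact_mod_cast hb i
  have hle : ∑ j ∈ Finset.Ico i k, (1 : ℚ) / b j ≤ k / b i := by
    calc ∑ j ∈ Finset.Ico i k, (1 : ℚ) / b j ≤ (Finset.Ico i k).card • ((1 : ℚ) / b i) := by
          apply Finset.sum_le_card_nsmul
          intro j hj
          rw [Finset.mem_Ico] at hj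
          apply one_div_le_one_div_of_le hbi
          exact_mod_cast hmono i j hj.1 hj.2
      _ ≤ k / b i := by
          rw [nsmul_eq_mul, mul_one_div, Nat.card_Ico]
          gcongr
          omega
  refine ⟨by linarith, fun D hD h => ?_⟩
  have hD' : (0 : ℚ) < D := by exact_mod_cast hD
  have h2 : (1 : ℚ) / D ≤ k / b i := by linarith
  rw [div_le_div_iff₀ hD' hbi] at h2
  have : (b i : ℚ) ≤ k * D := by linarith
  exact_mod_cast this

/-- Upper bound for the product of the first `i` terms. -/
def prodBd (k D : ℕ) : ℕ → ℕ
  | 0 => 1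
  | i + 1 => prodBd k D i * (if i < 8 then k * D else k * prodBd k D i)

/-- Upper bound for the `i`-th term. -/
def termBd (k D i : ℕ) : ℕ := if i < 8 then k * D else k * prodBd k D i

lemma prod_termBd (k D i : ℕ) : ∏ j ∈ Finset.range i, termBd k D j = prodBd k D i := by
  induction i with
  | zero => rfl
  | succ i ih => rw [Finset.prod_range_succ, ih]; rfl

lemma prodBd_small (k D i : ℕ) (hi : i ≤ 8) : prodBd k D i = (k * D) ^ i := by
  induction i with
  | zero => rfl
  | succ i ih =>
    have h : i < 8 := hi
    rw [prodBd, ih h.le, if_pos h, pow_succ]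

lemma prodBd_large (k D s : ℕ) : k * prodBd k D (8 + s) = (k * (k * D) ^ 8) ^ 2 ^ s := by
  induction s with
  | zero => simp [prodBd_small k D 8 le_rfl]
  | succ s ih =>
    rw [← add_assoc, prodBd, if_neg (by omega), pow_succ 2 s, pow_mul, ← ih]
    ring

lemma exists_termBd : ∃ D : ℕ, 0 < D ∧ ∀ (k : ℕ) (b : ℕ → ℕ), (∀ j, 0 < b j) →
    (∀ i j, i ≤ j → j < k → b i ≤ b j) →
    ∑ j ∈ Finset.range k, (1 : ℚ) / b j = 1 → ∀ i < k, b i ≤ termBd k D i := by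
  obtain ⟨D, hD, h⟩ := gap_exists 8 1 one_pos
  refine ⟨D, hD, fun k b hb hmono hsum i => ?_⟩
  induction i using Nat.strong_induction_on with
  | _ i ih =>
    intro hi
    obtain ⟨h1, h2⟩ := term_le k b hb hmono hsum i hi
    unfold termBd
    split_ifs with h8
    · exact h2 D hD (h _ b (by simp; omega) hb h1)
    · refine (h2 _ (Finset.prod_pos (fun j _ => hb j)) (one_div_prod_le b hb i h1)).trans ?_
      gcongr
      rw [← prod_termBd]
      apply Finset.prod_le_prod'
      intro j hj
      rw [Finset.mem_range] at hj
      exact ih j hj (by omega)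

lemma exists_numSols_le : ∃ D : ℕ, 0 < D ∧ ∀ k : ℕ, numSols k 1 1 ≤ prodBd k D k := by
  obtain ⟨D, hD, h⟩ := exists_termBd
  refine ⟨D, hD, fun k => ?_⟩
  have hsub : {a : Fin k → ℕ | (∀ i, 0 < a i) ∧ Monotone a ∧
      ((1 : ℕ) : ℚ) / (1 : ℕ) = ∑ i, (1 : ℚ) / a i} ⊆
      (Fintype.piFinset (fun i : Fin k => Finset.Icc 1 (termBd k D i)) : Finset (Fin k → ℕ)) := by
    rintro a ⟨ha, hmono, hsum⟩
    rw [Finset.mem_coe, Fintype.mem_piFinset]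
    intro i
    rw [Finset.mem_Icc]
    refine ⟨ha i, ?_⟩
    have hb := h k (fun j => if hj : j < k then a ⟨j, hj⟩ else 1) ?_ ?_ ?_ i i.2
    · simpa using hb
    · intro j
      by_cases hj : j < k
      · simpa [hj] using ha _
      · simp [hj]
    · intro p q hpq hq
      have hp : p < k := lt_of_le_of_lt hpq hq
      simp only [hp, hq, dif_pos]
      exact hmono hpq
    · rw [← Fin.sum_univ_eq_sum_range
        (fun j => (1 : ℚ) / ((if hj : j < k then a ⟨j, hj⟩ else 1 : ℕ) : ℚ))]
      simp only [Fin.is_lt, dif_pos, Fin.eta]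
      rw [← hsum]
      simp
  have hcard := Set.ncard_le_ncard hsub (Finset.finite_toSet _)
  rw [Set.ncard_coe_finset, Fintype.card_piFinset] at hcard
  simp only [Nat.card_Icc, Nat.add_sub_cancel] at hcard
  rw [Fin.prod_univ_eq_prod_range (fun j => termBd k D j), prod_termBd] at hcard
  exact hcard

theorem stmt_4 : ∀ ε : ℝ, 0 < ε → ∃ C : ℝ, 0 < C ∧
    ∀ k : ℕ, 1 ≤ k →
      (numSols k 1 1 : ℝ) ≤ C * (k : ℝ) ^ ((7 / 51 : ℝ) * 2 ^ (k - 1) + ε) := by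
  intro ε hε
  obtain ⟨D, hD, h⟩ := exists_numSols_le
  refine ⟨1 + ∑ k ∈ Finset.range (8 + D ^ 8), (numSols k 1 1 : ℝ), by positivity, ?_⟩
  intro k hk
  have hk1 : (1 : ℝ) ≤ k := by exact_mod_cast hk
  have hS : 0 ≤ ∑ k ∈ Finset.range (8 + D ^ 8), (numSols k 1 1 : ℝ) := by positivity
  by_cases hlt : k < 8 + D ^ 8
  · have h1 : (numSols k 1 1 : ℝ) ≤ ∑ k ∈ Finset.range (8 + D ^ 8), (numSols k 1 1 : ℝ) :=
      Finset.single_le_sum (f := fun k => (numSols k 1 1 : ℝ)) (fun _ _ => by positivity)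
        (Finset.mem_range.2 hlt)
    have h2 : (1 : ℝ) ≤ (k : ℝ) ^ ((7 / 51 : ℝ) * 2 ^ (k - 1) + ε) :=
      Real.one_le_rpow hk1 (by positivity)
    nlinarith
  · push Not at hlt
    obtain ⟨s, rfl⟩ : ∃ s, k = 8 + s := ⟨k - 8, by omega⟩
    have hn : numSols (8 + s) 1 1 ≤ (8 + s) ^ (10 * 2 ^ s) := by
      generalize hK : 8 + s = K at *
      calc numSols K 1 1 ≤ prodBd K D K := h K
        _ ≤ K * prodBd K D K := Nat.le_mul_of_pos_left _ (by omega)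
        _ = (K * (K * D) ^ 8) ^ 2 ^ s := by
            have := prodBd_large K D s
            rwa [hK] at this
        _ ≤ (K ^ 10) ^ 2 ^ s := by
            apply Nat.pow_le_pow_left
            calc K * (K * D) ^ 8 = K ^ 9 * D ^ 8 := by ring
              _ ≤ K ^ 9 * K := Nat.mul_le_mul_left _ (by omega)
              _ = K ^ 10 := by ring
        _ = K ^ (10 * 2 ^ s) := by rw [← pow_mul]
    have hexp : ((10 * 2 ^ s : ℕ) : ℝ) ≤ (7 / 51 : ℝ) * 2 ^ (8 + s - 1) + ε := by
      have : 8 + s - 1 = s + 7 := by omega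
      rw [this, pow_add]
      have : (0 : ℝ) < 2 ^ s := by positivity
      push_cast
      linarith
    have hr : (numSols (8 + s) 1 1 : ℝ) ≤
        ((8 + s : ℕ) : ℝ) ^ ((7 / 51 : ℝ) * 2 ^ (8 + s - 1) + ε) := by
      calc (numSols (8 + s) 1 1 : ℝ) ≤ ((8 + s : ℕ) : ℝ) ^ (10 * 2 ^ s) := by exact_mod_cast hn
        _ = ((8 + s : ℕ) : ℝ) ^ ((10 * 2 ^ s : ℕ) : ℝ) := (Real.rpow_natCast _ _).symm
        _ ≤ _ := Real.rpow_le_rpow_of_exponent_le hk1 hexp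
    refine hr.trans (le_mul_of_one_le_left (by positivity) (by linarith))
end
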